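/- arXiv:2210.12107 — 4 statements merged into one kernel-verified Lean document; each statement's English description precedes it below -/
import Mathlib

section
/- Let λ > μ > 0 and let M satisfy Condition (*). Let (ν_x)_{x>0} be Borel probability measures on [0,∞) with ∫ e^{sy} ν_x(dy) = G_M(log G₀(s;λ,μ))·e^{xΛ(s;λ,μ)} (an equality in (0,∞]) for every s ≤ s*(λ,μ), and ∫ e^{sy} ν_x(dy) = ∞ for every s > s*(λ,μ); let m_x := ∫ y ν_x(dy) be the mean of ν_x. Then for every family of positive numbers (ε_x)_{x>0} with ε_x → 0 and x·ε_x → ∞ as x → ∞, the centered and rescaled family satisfies: (a) for every closed set F ⊆ ℝ, limsup_{x→∞} ε_x·log ν_x({y : (y − m_x)/√(x/ε_x) ∈ F}) ≤ −inf_{z∈F} z²(λ−μ)³/(16λμ); (b) for every open set G ⊆ ℝ, liminf_{x→∞} ε_x·log ν_x({y : (y − m_x)/√(x/ε_x) ∈ G}) ≥ −inf_{z∈G} z²(λ−μ)³/(16λμ). -/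
open MeasureTheory ProbabilityTheory Filter
open scoped ENNReal

/-- `s*(λ,μ) = (√λ − √μ)²/2`. -/
noncomputable def sStar (l m : ℝ) : ℝ := (Real.sqrt l - Real.sqrt m) ^ 2 / 2

/-- `G₀(s;λ,μ)`. -/
noncomputable def Gzero (s l m : ℝ) : ℝ :=
  (l + m - 2 * s - Real.sqrt ((l + m - 2 * s) ^ 2 - 4 * l * m)) / (2 * m)

/-- `Λ(s;λ,μ)`. -/
noncomputable def Lam (s l m : ℝ) : ℝ :=
  (l - m - Real.sqrt ((l + m - 2 * s) ^ 2 - 4 * l * m)) / 2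

section QuadraticGartnerEllis

open scoped Topology

lemma mul_log_le_of_le_exp {e c : ℝ} (he : 0 < e) {p : ℝ≥0∞}
    (h : p ≤ ENNReal.ofReal (Real.exp (c / e))) : (e : EReal) * ENNReal.log p ≤ c := by
  have h1 : ENNReal.log p ≤ ((c / e : ℝ) : EReal) := by
    have := ENNReal.log_monotone h
    rwa [ENNReal.log_ofReal_of_pos (Real.exp_pos _), Real.log_exp] at this
  calc (e : EReal) * ENNReal.log p ≤ (e : EReal) * ((c / e : ℝ) : EReal) :=
        mul_le_mul_of_nonneg_left h1 (EReal.coe_nonneg.2 he.le)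
    _ = c := by rw [← EReal.coe_mul, mul_div_cancel₀ _ he.ne']

lemma le_mul_log_of_exp_le {e c : ℝ} (he : 0 < e) {p : ℝ≥0∞}
    (h : ENNReal.ofReal (Real.exp (c / e)) ≤ p) : (c : EReal) ≤ (e : EReal) * ENNReal.log p := by
  have h1 : ((c / e : ℝ) : EReal) ≤ ENNReal.log p := by
    have := ENNReal.log_monotone h
    rwa [ENNReal.log_ofReal_of_pos (Real.exp_pos _), Real.log_exp] at this
  calc (c : EReal) = (e : EReal) * ((c / e : ℝ) : EReal) := by
        rw [← EReal.coe_mul, mul_div_cancel₀ _ he.ne']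
    _ ≤ _ := mul_le_mul_of_nonneg_left h1 (EReal.coe_nonneg.2 he.le)

lemma two_mul_exp_div_le {e a η : ℝ} (he : 0 < e) (h : e * Real.log 2 ≤ η) :
    2 * Real.exp (a / e) ≤ Real.exp ((a + η) / e) := by
  have h2 : (2 : ℝ) ≤ Real.exp (η / e) := by
    rw [← Real.log_le_iff_le_exp (by norm_num), le_div_iff₀ he]
    linarith
  rw [add_div, Real.exp_add]
  nlinarith [Real.exp_pos (a / e)]

variable {Ω : Type*} [MeasurableSpace Ω]

/-- Exponential Markov inequality, under the exponential weight `exp (s * Z / e)`. -/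
lemma setLIntegral_exp_le_of_le_mul (P : Measure Ω) {Z : Ω → ℝ} (hZ : Measurable Z)
    {e : ℝ} (he : 0 < e) {S : Set Ω} {c t : ℝ} (hS : ∀ ω ∈ S, c ≤ t * Z ω) {s A : ℝ}
    (hA : ∫⁻ ω, ENNReal.ofReal (Real.exp ((s + t) * Z ω / e)) ∂P
      = ENNReal.ofReal (Real.exp (A / e))) :
    ∫⁻ ω in S, ENNReal.ofReal (Real.exp (s * Z ω / e)) ∂P
      ≤ ENNReal.ofReal (Real.exp ((A - c) / e)) := by
  calc ∫⁻ ω in S, ENNReal.ofReal (Real.exp (s * Z ω / e)) ∂P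
      ≤ ∫⁻ ω in S, ENNReal.ofReal (Real.exp (-c / e))
          * ENNReal.ofReal (Real.exp ((s + t) * Z ω / e)) ∂P := by
        refine setLIntegral_mono (by fun_prop) fun ω hω => ?_
        rw [← ENNReal.ofReal_mul (Real.exp_pos _).le, ← Real.exp_add, ← add_div]
        gcongr
        linarith [hS ω hω]
    _ ≤ ∫⁻ ω, ENNReal.ofReal (Real.exp (-c / e))
          * ENNReal.ofReal (Real.exp ((s + t) * Z ω / e)) ∂P := setLIntegral_le_lintegral _ _
    _ = ENNReal.ofReal (Real.exp ((A - c) / e)) := by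
        rw [lintegral_const_mul _ (by fun_prop), hA, ← ENNReal.ofReal_mul (Real.exp_pos _).le,
          ← Real.exp_add, ← add_div]
        congr 3
        ring

lemma measure_le_exp_of_le_mul (P : Measure Ω) {Z : Ω → ℝ} (hZ : Measurable Z)
    {e : ℝ} (he : 0 < e) {S : Set Ω} {c t : ℝ} (hS : ∀ ω ∈ S, c ≤ t * Z ω) {A : ℝ}
    (hA : ∫⁻ ω, ENNReal.ofReal (Real.exp (t * Z ω / e)) ∂P = ENNReal.ofReal (Real.exp (A / e))) :
    P S ≤ ENNReal.ofReal (Real.exp ((A - c) / e)) := by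
  simpa using setLIntegral_exp_le_of_le_mul P hZ he hS (s := 0) (A := A) (by simpa using hA)

variable {ι : Type*} {f : Filter ι} {P : ι → Measure Ω} {Z : ι → Ω → ℝ} {e : ι → ℝ} {v : ℝ}

theorem limsup_mul_log_le_of_quadratic (hv : 0 < v)
    (hZ : ∀ i, Measurable (Z i)) (he : ∀ᶠ i in f, 0 < e i) (he0 : Tendsto e f (𝓝 0))
    (hA : ∀ t : ℝ, ∃ A : ι → ℝ, Tendsto A f (𝓝 (t ^ 2 * v / 2)) ∧ ∀ᶠ i in f,
      ∫⁻ ω, ENNReal.ofReal (Real.exp (t * Z i ω / e i)) ∂P i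
        = ENNReal.ofReal (Real.exp (A i / e i))) (F : Set ℝ) :
    limsup (fun i => (e i : EReal) * ENNReal.log (P i {ω | Z i ω ∈ F})) f
      ≤ -((⨅ z ∈ F, ENNReal.ofReal (z ^ 2 / (2 * v)) : ℝ≥0∞) : EReal) := by
  refine le_of_forall_gt_imp_ge_of_dense fun b hb => ?_
  obtain ⟨c₁, hc1, hc2⟩ := EReal.lt_iff_exists_real_btwn.1 hb
  obtain ⟨c, rfl⟩ : ∃ c, c₁ = -c := ⟨-c₁, by ring⟩
  have hc1 : (c : EReal) < ((⨅ z ∈ F, ENNReal.ofReal (z ^ 2 / (2 * v)) : ℝ≥0∞) : EReal) := by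
    rw [EReal.coe_neg] at hc1
    exact EReal.neg_lt_neg_iff.1 hc1
  set d : ℝ := Real.sqrt (2 * v * c) with hd
  have hdF : ∀ z ∈ F, d ≤ |z| := by
    intro z hz
    have h1 : (c : EReal) < ((ENNReal.ofReal (z ^ 2 / (2 * v)) : ℝ≥0∞) : EReal) :=
      hc1.trans_le (EReal.coe_ennreal_le_coe_ennreal_iff.2 (iInf₂_le z hz))
    rw [EReal.coe_ennreal_ofReal, max_eq_left (by positivity), EReal.coe_lt_coe_iff,
      lt_div_iff₀ (by positivity)] at h1
    rw [hd]
    exact Real.sqrt_le_iff.2 ⟨abs_nonneg _, by rw [sq_abs]; linarith⟩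
  have hd2 : c ≤ d ^ 2 / (2 * v) := by
    rw [le_div_iff₀ (by positivity)]
    rcases le_total 0 c with h | h
    · rw [hd, Real.sq_sqrt (by positivity)]; linarith
    · nlinarith [sq_nonneg d]
  have hd0 : 0 ≤ d := Real.sqrt_nonneg _
  obtain ⟨η, hη, hηb⟩ : ∃ η : ℝ, 0 < η ∧ ((-c + 2 * η : ℝ) : EReal) ≤ b := by
    obtain ⟨c₂, h1, h2⟩ := EReal.lt_iff_exists_real_btwn.1 hc2
    have h1 := EReal.coe_lt_coe_iff.1 h1
    refine ⟨(c₂ + c) / 2, by linarith, ?_⟩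
    rw [show -c + 2 * ((c₂ + c) / 2) = c₂ by ring]
    exact h2.le
  obtain ⟨A, hAt, hAe⟩ := hA (d / v)
  obtain ⟨B, hBt, hBe⟩ := hA (-(d / v))
  have hlim : (d / v) ^ 2 * v / 2 = d ^ 2 / (2 * v) := by field_simp
  rw [hlim] at hAt
  rw [neg_sq, hlim] at hBt
  have hdd : d ^ 2 / (2 * v) - d / v * d = - (d ^ 2 / (2 * v)) := by field_simp; ring
  have hlog : Tendsto (fun i => e i * Real.log 2) f (𝓝 0) := by simpa using he0.mul_const _
  refine le_trans (limsup_le_of_le (by isBoundedDefault) ?_) hηb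
  filter_upwards [he, hAe, hBe, hAt.eventually_lt_const (lt_add_of_pos_right _ hη),
    hBt.eventually_lt_const (lt_add_of_pos_right _ hη), hlog.eventually_lt_const hη]
    with i hi hAi hBi hAl hBl hli
  apply mul_log_le_of_le_exp hi
  have hsub : {ω | Z i ω ∈ F} ⊆ {ω | d ≤ Z i ω} ∪ {ω | Z i ω ≤ -d} := by
    intro ω hω
    rcases le_abs.1 (hdF _ hω) with h | h
    · exact Or.inl h
    · exact Or.inr (by simp only [Set.mem_ofPred_eq]; linarith)
  have hU : P i {ω | d ≤ Z i ω} ≤ ENNReal.ofReal (Real.exp ((-c + η) / e i)) := by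
    refine (measure_le_exp_of_le_mul (P i) (hZ i) hi (c := d / v * d) (fun ω hω => ?_) hAi).trans ?_
    · exact mul_le_mul_of_nonneg_left hω (by positivity)
    · gcongr; linarith
  have hL : P i {ω | Z i ω ≤ -d} ≤ ENNReal.ofReal (Real.exp ((-c + η) / e i)) := by
    refine (measure_le_exp_of_le_mul (P i) (hZ i) hi (c := d / v * d) (fun ω hω => ?_) hBi).trans ?_
    · have := mul_le_mul_of_nonneg_left (le_neg.1 (Set.mem_ofPred_eq ▸ hω))
        (show 0 ≤ d / v by positivity)
      linarith
    · gcongr; linarith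
  calc P i {ω | Z i ω ∈ F} ≤ P i {ω | d ≤ Z i ω} + P i {ω | Z i ω ≤ -d} :=
        (measure_mono hsub).trans (measure_union_le _ _)
    _ ≤ ENNReal.ofReal (Real.exp ((-c + η) / e i)) + ENNReal.ofReal (Real.exp ((-c + η) / e i)) :=
        add_le_add hU hL
    _ = ENNReal.ofReal (2 * Real.exp ((-c + η) / e i)) := by
        rw [← ENNReal.ofReal_add (Real.exp_pos _).le (Real.exp_pos _).le, two_mul]
    _ ≤ ENNReal.ofReal (Real.exp ((-c + 2 * η) / e i)) := by
        rw [show -c + 2 * η = (-c + η) + η by ring]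
        exact ENNReal.ofReal_le_ofReal (two_mul_exp_div_le hi hli.le)

lemma eventually_exp_le_measure_ball_of_quadratic (hv : 0 < v)
    (hZ : ∀ i, Measurable (Z i)) (he : ∀ᶠ i in f, 0 < e i) (he0 : Tendsto e f (𝓝 0))
    (hA : ∀ t : ℝ, ∃ A : ι → ℝ, Tendsto A f (𝓝 (t ^ 2 * v / 2)) ∧ ∀ᶠ i in f,
      ∫⁻ ω, ENNReal.ofReal (Real.exp (t * Z i ω / e i)) ∂P i
        = ENNReal.ofReal (Real.exp (A i / e i))) (z : ℝ) {δ η : ℝ} (hδ : 0 < δ)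
    (hη : 0 < η) (hηδ : 4 * η ≤ δ ^ 2 / (2 * v)) :
    ∀ᶠ i in f, ENNReal.ofReal (Real.exp ((-(z ^ 2 / (2 * v)) - |z / v| * δ - 2 * η) / e i))
      ≤ P i {ω | |Z i ω - z| < δ} := by
  set s := z / v with hs
  obtain ⟨A, hAt, hAe⟩ := hA s
  obtain ⟨B, hBt, hBe⟩ := hA (s + δ / v)
  obtain ⟨C, hCt, hCe⟩ := hA (s + -(δ / v))
  have hz : z = s * v := by rw [hs]; field_simp
  have h1 : (s + δ / v) ^ 2 * v / 2 - δ / v * (z + δ) = s ^ 2 * v / 2 - δ ^ 2 / (2 * v) := by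
    rw [hz]; field_simp; ring
  have h2 : (s + -(δ / v)) ^ 2 * v / 2 - -(δ / v) * (z - δ) = s ^ 2 * v / 2 - δ ^ 2 / (2 * v) := by
    rw [hz]; field_simp; ring
  have hlog : Tendsto (fun i => e i * Real.log 2) f (𝓝 0) := by simpa using he0.mul_const _
  filter_upwards [he, hAe, hBe, hCe, hAt.eventually_const_lt (sub_lt_self _ hη),
    hBt.eventually_lt_const (lt_add_of_pos_right _ hη),
    hCt.eventually_lt_const (lt_add_of_pos_right _ hη), hlog.eventually_lt_const hη]
    with i hi hAi hBi hCi hAl hBl hCl hli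
  set X := s ^ 2 * v / 2 with hX
  set S := {ω | |Z i ω - z| < δ} with hS
  have hU : ∫⁻ ω in {ω | z + δ ≤ Z i ω}, ENNReal.ofReal (Real.exp (s * Z i ω / e i)) ∂P i
      ≤ ENNReal.ofReal (Real.exp ((X - 3 * η) / e i)) := by
    refine (setLIntegral_exp_le_of_le_mul (P i) (hZ i) hi (c := δ / v * (z + δ))
      (fun ω hω => ?_) hBi).trans ?_
    · exact mul_le_mul_of_nonneg_left hω (by positivity)
    · exact ENNReal.ofReal_le_ofReal (Real.exp_le_exp.2
        (div_le_div_of_nonneg_right (by linarith) hi.le))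
  have hL : ∫⁻ ω in {ω | Z i ω ≤ z - δ}, ENNReal.ofReal (Real.exp (s * Z i ω / e i)) ∂P i
      ≤ ENNReal.ofReal (Real.exp ((X - 3 * η) / e i)) := by
    refine (setLIntegral_exp_le_of_le_mul (P i) (hZ i) hi (c := -(δ / v) * (z - δ))
      (fun ω hω => ?_) hCi).trans ?_
    · exact mul_le_mul_of_nonpos_left hω (neg_nonpos.2 (by positivity))
    · exact ENNReal.ofReal_le_ofReal (Real.exp_le_exp.2
        (div_le_div_of_nonneg_right (by linarith) hi.le))
  have hB : ∫⁻ ω in S, ENNReal.ofReal (Real.exp (s * Z i ω / e i)) ∂P i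
      ≤ ENNReal.ofReal (Real.exp ((s * z + |s| * δ) / e i)) * P i S := by
    rw [← setLIntegral_const]
    refine setLIntegral_mono (by fun_prop) fun ω hω => ?_
    have h3 : s * (Z i ω - z) ≤ |s| * δ := (le_abs_self _).trans <| by
      rw [abs_mul]; exact mul_le_mul_of_nonneg_left (le_of_lt hω) (abs_nonneg _)
    gcongr
    linarith
  have hcover : (Set.univ : Set Ω) ⊆ S ∪ ({ω | z + δ ≤ Z i ω} ∪ {ω | Z i ω ≤ z - δ}) := by
    intro ω _
    by_cases h : |Z i ω - z| < δ
    · exact Or.inl h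
    · rcases le_abs.1 (not_lt.1 h) with h | h
      · exact Or.inr (Or.inl (by simp only [Set.mem_ofPred_eq]; linarith))
      · exact Or.inr (Or.inr (by simp only [Set.mem_ofPred_eq]; linarith))
  have key : ENNReal.ofReal (Real.exp (A i / e i))
      ≤ ENNReal.ofReal (Real.exp ((s * z + |s| * δ) / e i)) * P i S
        + ENNReal.ofReal (Real.exp ((X - 2 * η) / e i)) := by
    calc ENNReal.ofReal (Real.exp (A i / e i))
        = ∫⁻ ω in Set.univ, ENNReal.ofReal (Real.exp (s * Z i ω / e i)) ∂P i := by
          rw [setLIntegral_univ, hAi]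
      _ ≤ _ := lintegral_mono_set hcover
      _ ≤ _ := lintegral_union_le _ _ _
      _ ≤ _ := add_le_add hB ((lintegral_union_le _ _ _).trans (add_le_add hU hL))
      _ ≤ _ := by
        rw [← ENNReal.ofReal_add (Real.exp_pos _).le (Real.exp_pos _).le, ← two_mul,
          show X - 2 * η = (X - 3 * η) + η by ring]
        gcongr
        exact two_mul_exp_div_le hi hli.le
  have h4 : ENNReal.ofReal (Real.exp ((X - 2 * η) / e i))
        + ENNReal.ofReal (Real.exp ((X - 2 * η) / e i)) ≤ ENNReal.ofReal (Real.exp (A i / e i)) := by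
    rw [← ENNReal.ofReal_add (Real.exp_pos _).le (Real.exp_pos _).le, ← two_mul]
    refine ENNReal.ofReal_le_ofReal ((two_mul_exp_div_le hi hli.le).trans ?_)
    gcongr
    linarith
  have h5 := ENNReal.le_of_add_le_add_right ENNReal.ofReal_ne_top (h4.trans key)
  have h6 : -(z ^ 2 / (2 * v)) = X - s * z := by rw [hX, hz]; field_simp; ring
  calc ENNReal.ofReal (Real.exp ((-(z ^ 2 / (2 * v)) - |s| * δ - 2 * η) / e i))
      = ENNReal.ofReal (Real.exp (-(s * z + |s| * δ) / e i))
          * ENNReal.ofReal (Real.exp ((X - 2 * η) / e i)) := by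
        rw [← ENNReal.ofReal_mul (Real.exp_pos _).le, ← Real.exp_add, ← add_div, h6]
        congr 3
        ring
    _ ≤ ENNReal.ofReal (Real.exp (-(s * z + |s| * δ) / e i))
          * (ENNReal.ofReal (Real.exp ((s * z + |s| * δ) / e i)) * P i S) := by gcongr
    _ = P i S := by
        rw [← mul_assoc, ← ENNReal.ofReal_mul (Real.exp_pos _).le, ← Real.exp_add, ← add_div]
        simp

theorem le_liminf_mul_log_of_quadratic (hv : 0 < v)
    (hZ : ∀ i, Measurable (Z i)) (he : ∀ᶠ i in f, 0 < e i) (he0 : Tendsto e f (𝓝 0))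
    (hA : ∀ t : ℝ, ∃ A : ι → ℝ, Tendsto A f (𝓝 (t ^ 2 * v / 2)) ∧ ∀ᶠ i in f,
      ∫⁻ ω, ENNReal.ofReal (Real.exp (t * Z i ω / e i)) ∂P i
        = ENNReal.ofReal (Real.exp (A i / e i))) {G : Set ℝ} (hG : IsOpen G) :
    -((⨅ z ∈ G, ENNReal.ofReal (z ^ 2 / (2 * v)) : ℝ≥0∞) : EReal)
      ≤ liminf (fun i => (e i : EReal) * ENNReal.log (P i {ω | Z i ω ∈ G})) f := by
  refine le_of_forall_lt_imp_le_of_dense fun b hb => ?_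
  have hb := EReal.lt_neg_comm.1 hb
  rw [← EReal.coe_toENNReal ((EReal.coe_ennreal_nonneg _).trans hb.le),
    EReal.coe_ennreal_lt_coe_ennreal_iff] at hb
  simp only [iInf_lt_iff] at hb
  obtain ⟨z, hzG, hzb⟩ := hb
  have hb0 : 0 < -b := by
    by_contra h
    rw [EReal.toENNReal_of_nonpos (not_lt.1 h)] at hzb
    exact not_lt_bot hzb
  rw [← EReal.coe_ennreal_lt_coe_ennreal_iff, EReal.coe_toENNReal hb0.le, EReal.coe_ennreal_ofReal,
    max_eq_left (by positivity)] at hzb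
  obtain ⟨c, hc1, hc2⟩ := EReal.lt_iff_exists_real_btwn.1 hzb
  have hc1 := EReal.coe_lt_coe_iff.1 hc1
  have hbc : b ≤ ((-c : ℝ) : EReal) := by
    rw [EReal.coe_neg]; exact (EReal.lt_neg_comm.1 hc2).le
  obtain ⟨r, hr, hrG⟩ := Metric.isOpen_iff.1 hG z hzG
  set κ := c - z ^ 2 / (2 * v) with hκ
  have hκ0 : 0 < κ := by rw [hκ]; linarith
  set δ := min r (κ / (2 * (|z / v| + 1))) with hδ
  have hδ0 : 0 < δ := by rw [hδ]; positivity
  have hδκ : |z / v| * δ ≤ κ / 2 := by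
    calc |z / v| * δ ≤ (|z / v| + 1) * (κ / (2 * (|z / v| + 1))) :=
          mul_le_mul (by linarith) (min_le_right _ _) hδ0.le (by positivity)
      _ = κ / 2 := by field_simp
  set η := min (κ / 4) (δ ^ 2 / (2 * v) / 4) with hη
  have hη0 : 0 < η := by rw [hη]; positivity
  have hη1 : η ≤ κ / 4 := min_le_left _ _
  have hη2 : η ≤ δ ^ 2 / (2 * v) / 4 := min_le_right _ _
  refine hbc.trans (le_liminf_of_le (by isBoundedDefault) ?_)
  filter_upwards [he, eventually_exp_le_measure_ball_of_quadratic hv hZ he he0 hA z hδ0 hη0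
    (by linarith)] with i hi hball
  apply le_mul_log_of_exp_le hi
  calc _ ≤ ENNReal.ofReal (Real.exp ((-(z ^ 2 / (2 * v)) - |z / v| * δ - 2 * η) / e i)) := by
        gcongr
        linarith
    _ ≤ _ := hball
    _ ≤ _ := measure_mono fun ω hω => hrG (by
        rw [Metric.mem_ball, Real.dist_eq]
        exact lt_of_lt_of_le hω (min_le_left _ _))

end QuadraticGartnerEllis

section ScaledFamily

open scoped Topology

lemma hasDerivAt_zero_of_eq_linear_add_sq_mul {L φ : ℝ → ℝ} {b : ℝ}
    (hL : ∀ᶠ s in 𝓝 0, L s = b * s + s ^ 2 * φ s) (hφ : ContinuousAt φ 0) :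
    HasDerivAt L b 0 := by
  rw [hasDerivAt_iff_tendsto_slope_zero]
  have h0 : L 0 = 0 := by simpa using hL.self_of_nhds
  have hlim : Tendsto (fun s => b + s * φ s) (𝓝[≠] 0) (𝓝 b) := by
    have : Tendsto (fun s => b + s * φ s) (𝓝 0) (𝓝 (b + 0 * φ 0)) :=
      tendsto_const_nhds.add (tendsto_id.mul hφ)
    simpa using this.mono_left nhdsWithin_le_nhds
  refine hlim.congr' ?_
  filter_upwards [nhdsWithin_le_nhds hL, self_mem_nhdsWithin] with s hs hs0
  have hs0 : s ≠ 0 := hs0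
  rw [zero_add, h0, hs, smul_eq_mul]
  field_simp
  ring

variable {ν : ℝ → Measure ℝ} {H L φ ε : ℝ → ℝ} {b : ℝ}

lemma integral_id_eq_of_lintegral_exp_eq
    (hmgf : ∀ᶠ s in 𝓝 0, ∀ x > 0, ∫⁻ y, ENNReal.ofReal (Real.exp (s * y)) ∂(ν x)
      = ENNReal.ofReal (H s * Real.exp (x * L s)))
    (hH : DifferentiableAt ℝ H 0) (hH0 : H 0 = 1) (hH_pos : ∀ᶠ s in 𝓝 0, 0 < H s)
    (hL : HasDerivAt L b 0) (hL0 : L 0 = 0) {x : ℝ} (hx : 0 < x) :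
    ∫ y, y ∂(ν x) = deriv H 0 + x * b := by
  have hint : ∀ᶠ s in 𝓝 0, Integrable (fun y => Real.exp (s * y)) (ν x) := by
    filter_upwards [hmgf] with s hs
    rw [← lintegral_ofReal_ne_top_iff_integrable (by fun_prop)
      (Eventually.of_forall fun y => (Real.exp_pos _).le), hs x hx]
    exact ENNReal.ofReal_ne_top
  have hmem : (0 : ℝ) ∈ interior (integrableExpSet (fun y : ℝ => y) (ν x)) :=
    mem_interior_iff_mem_nhds.2 hint
  rw [← deriv_mgf_zero hmem]
  have heq : mgf (fun y : ℝ => y) (ν x) =ᶠ[𝓝 0] fun s => H s * Real.exp (x * L s) := by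
    filter_upwards [hmgf, hint, hH_pos] with s hs hi hp
    have := hs x hx
    rw [← ofReal_integral_eq_lintegral_ofReal hi
      (Eventually.of_forall fun y => (Real.exp_pos _).le)] at this
    exact (ENNReal.ofReal_eq_ofReal_iff (integral_nonneg fun y => (Real.exp_pos _).le)
      (by positivity)).1 this
  rw [heq.deriv_eq]
  have hd := hH.hasDerivAt.mul (hL.const_mul x).exp
  simp only [hL0, hH0, mul_zero, Real.exp_zero, mul_one, one_mul] at hd
  exact hd.deriv

lemma exists_tendsto_lintegral_exp_scaled
    (hmgf : ∀ᶠ s in 𝓝 0, ∀ x > 0, ∫⁻ y, ENNReal.ofReal (Real.exp (s * y)) ∂(ν x)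
      = ENNReal.ofReal (H s * Real.exp (x * L s)))
    (hH : DifferentiableAt ℝ H 0) (hH0 : H 0 = 1)
    (hL : ∀ᶠ s in 𝓝 0, L s = b * s + s ^ 2 * φ s) (hφ : ContinuousAt φ 0)
    (hε : ∀ x > 0, 0 < ε x) (hε0 : Tendsto ε atTop (𝓝 0))
    (hxε : Tendsto (fun x => x * ε x) atTop atTop) (t : ℝ) :
    ∃ A : ℝ → ℝ, Tendsto A atTop (𝓝 (t ^ 2 * (2 * φ 0) / 2)) ∧ ∀ᶠ x in atTop,
      ∫⁻ y, ENNReal.ofReal (Real.exp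
          (t * ((y - ∫ u, u ∂(ν x)) / Real.sqrt (x / ε x)) / ε x)) ∂(ν x)
        = ENNReal.ofReal (Real.exp (A x / ε x)) := by
  have hH_pos : ∀ᶠ s in 𝓝 0, 0 < H s :=
    hH.continuousAt.eventually_const_lt (by rw [hH0]; exact one_pos)
  have hmean : ∀ x > 0, ∫ y, y ∂(ν x) = deriv H 0 + x * b := fun x hx =>
    integral_id_eq_of_lintegral_exp_eq hmgf hH hH0 hH_pos
      (hasDerivAt_zero_of_eq_linear_add_sq_mul hL hφ) (by simpa using hL.self_of_nhds) hx
  set σ : ℝ → ℝ := fun x => t / Real.sqrt (x * ε x) with hσ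
  have hσ0 : Tendsto σ atTop (𝓝 0) := (Real.tendsto_sqrt_atTop.comp hxε).const_div_atTop t
  refine ⟨fun x => ε x * Real.log (H (σ x)) - ε x * (σ x * deriv H 0) + t ^ 2 * φ (σ x), ?_, ?_⟩
  · have h1 : Tendsto (fun x => Real.log (H (σ x))) atTop (𝓝 0) := by
      have h : ContinuousAt (fun s => Real.log (H s)) 0 := hH.continuousAt.log (by simp [hH0])
      have := h.tendsto.comp hσ0
      simpa [hH0, Function.comp_def] using this
    have := ((hε0.mul h1).sub (hε0.mul (hσ0.mul_const (deriv H 0)))).add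
      ((hφ.tendsto.comp hσ0).const_mul (t ^ 2))
    rw [show t ^ 2 * (2 * φ 0) / 2 = 0 * 0 - 0 * (0 * deriv H 0) + t ^ 2 * φ 0 by ring]
    exact this
  · filter_upwards [eventually_gt_atTop 0, hσ0.eventually hmgf, hσ0.eventually hL,
      hσ0.eventually hH_pos] with x hx h1 h2 h3
    have hεx := hε x hx
    have hsq : Real.sqrt (x / ε x) = Real.sqrt (x * ε x) / ε x := by
      rw [show x / ε x = x * ε x / ε x ^ 2 by field_simp, Real.sqrt_div (by positivity),
        Real.sqrt_sq hεx.le]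
    have hpos : 0 < Real.sqrt (x * ε x) := Real.sqrt_pos.2 (by positivity)
    have hxσ : ε x * (x * σ x ^ 2) = t ^ 2 := by
      rw [hσ]
      simp only [div_pow]
      rw [Real.sq_sqrt (by positivity)]
      field_simp
    have hexp : ∀ y, t * ((y - ∫ u, u ∂(ν x)) / Real.sqrt (x / ε x)) / ε x
        = -(σ x * ∫ u, u ∂(ν x)) + σ x * y := by
      intro y
      rw [hsq, hσ]
      field_simp
      ring
    simp_rw [hexp, Real.exp_add, ENNReal.ofReal_mul (Real.exp_pos _).le]
    rw [lintegral_const_mul _ (by fun_prop), h1 x hx, ← ENNReal.ofReal_mul (Real.exp_pos _).le,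
      hmean x hx]
    congr 1
    nth_rewrite 1 [← Real.exp_log h3]
    rw [← Real.exp_add, ← Real.exp_add, h2]
    congr 1
    rw [← hxσ]
    field_simp
    ring

end ScaledFamily

section AbsorptionTime

open scoped Topology

lemma Lam_eq_linear_add_sq_mul {l m s : ℝ} (hlm : m < l)
    (hs : 0 ≤ (l + m - 2 * s) ^ 2 - 4 * l * m) :
    Lam s l m = (l + m) / (l - m) * s + s ^ 2 *
      (4 * (l + m) * (l + m - s)
          / ((l - m) * (l - m + Real.sqrt ((l + m - 2 * s) ^ 2 - 4 * l * m)) ^ 2)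
        - 2 / (l - m + Real.sqrt ((l + m - 2 * s) ^ 2 - 4 * l * m))) := by
  have hR := Real.sq_sqrt hs
  have hR0 := Real.sqrt_nonneg ((l + m - 2 * s) ^ 2 - 4 * l * m)
  rw [Lam]
  set R := Real.sqrt ((l + m - 2 * s) ^ 2 - 4 * l * m)
  set a := l - m with ha
  have ha0 : 0 < a := sub_pos.2 hlm
  have haR : a + R ≠ 0 := by positivity
  have h1 : (a - R) * (a + R) = 4 * s * (l + m - s) := by
    rw [ha]
    linear_combination -hR
  have h2 : (l + m) / a * s = 2 * s * (l + m) / (a + R) - s * (l + m) * (a - R) / (a * (a + R)) := by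
    field_simp
    ring
  have h3 : a - R = 4 * s * (l + m - s) / (a + R) := by
    field_simp
    linear_combination h1
  rw [h2, h3]
  field_simp
  ring

lemma discriminant_zero_pos {l m : ℝ} (hlm : m < l) :
    0 < (l + m - 2 * 0) ^ 2 - 4 * l * m := by
  nlinarith [mul_pos (sub_pos.2 hlm) (sub_pos.2 hlm)]

lemma sqrt_discriminant_zero {l m : ℝ} (hlm : m < l) :
    Real.sqrt ((l + m - 2 * 0) ^ 2 - 4 * l * m) = l - m := by
  rw [show (l + m - 2 * 0) ^ 2 - 4 * l * m = (l - m) ^ 2 by ring, Real.sqrt_sq (by linarith)]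

lemma Gzero_zero {l m : ℝ} (hlm : m < l) (hm : 0 < m) : Gzero 0 l m = 1 := by
  rw [Gzero, sqrt_discriminant_zero hlm]
  field_simp
  ring

lemma differentiableAt_Gzero {l m : ℝ} (hlm : m < l) :
    DifferentiableAt ℝ (fun s => Gzero s l m) 0 := by
  have h : DifferentiableAt ℝ (fun s => Real.sqrt ((l + m - 2 * s) ^ 2 - 4 * l * m)) 0 :=
    DifferentiableAt.sqrt (by fun_prop) (discriminant_zero_pos hlm).ne'
  unfold Gzero
  fun_prop

lemma sStar_pos {l m : ℝ} (hlm : m < l) (hm : 0 < m) : 0 < sStar l m := by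
  have := Real.sqrt_lt_sqrt hm.le hlm
  have := sub_pos.2 this
  rw [sStar]
  positivity

lemma zero_mem_interior_integrableExpSet_of_nonneg {Θ : Type*} [MeasurableSpace Θ]
    {Q : Measure Θ} [IsFiniteMeasure Q] {X : Θ → ℝ} (hX : Measurable X) (hX0 : ∀ θ, 0 ≤ X θ)
    {r : ℝ} (hr : 0 < r) (h : ∫⁻ θ, ENNReal.ofReal (Real.exp (r * X θ)) ∂Q < ⊤) :
    (0 : ℝ) ∈ interior (integrableExpSet X Q) := by
  have hint : Integrable (fun θ => Real.exp (r * X θ)) Q :=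
    (lintegral_ofReal_ne_top_iff_integrable (by fun_prop)
      (Eventually.of_forall fun y => (Real.exp_pos _).le)).1 h.ne
  refine mem_interior.2 ⟨Set.Iio r, fun t ht => ?_, isOpen_Iio, hr⟩
  refine hint.mono' (by fun_prop) (Eventually.of_forall fun θ => ?_)
  rw [Real.norm_eq_abs, Real.abs_exp]
  exact Real.exp_le_exp.2 (mul_le_mul_of_nonneg_right (le_of_lt ht) (hX0 θ))

end AbsorptionTime

/-- moderate deviations for `(A_x(λ,μ) − E[A_x(λ,μ)])/√(x/ε_x)` as `x → ∞`,
with speed `1/ε_x` and rate `z²(λ−μ)³/(16λμ)`. -/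
theorem md_scaling1
    {Θ : Type*} [MeasurableSpace Θ] (Q : Measure Θ) [IsProbabilityMeasure Q]
    (M : Θ → ℕ) (hMmeas : Measurable M) (hM1 : ∀ θ, 1 ≤ M θ)
    (l m : ℝ) (hlm : m < l) (hm : 0 < m)
    -- Condition (*)
    (hcond : ∃ r : ℝ, 0 < r ∧ ∫⁻ θ, ENNReal.ofReal (Real.exp (r * (M θ : ℝ))) ∂Q < ⊤)
    -- the laws ν_x of the absorption times A_x(λ,μ)
    (ν : ℝ → Measure ℝ) (hprob : ∀ x > 0, IsProbabilityMeasure (ν x))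
    (hsupp : ∀ x > 0, ν x (Set.Iio 0) = 0)
    (hmgf_le : ∀ x > 0, ∀ s ≤ sStar l m,
      ∫⁻ y, ENNReal.ofReal (Real.exp (s * y)) ∂(ν x)
        = (∫⁻ θ, ENNReal.ofReal (Real.exp (Real.log (Gzero s l m) * (M θ : ℝ))) ∂Q)
            * ENNReal.ofReal (Real.exp (x * Lam s l m)))
    (hmgf_gt : ∀ x > 0, ∀ s > sStar l m,
      ∫⁻ y, ENNReal.ofReal (Real.exp (s * y)) ∂(ν x) = ⊤)
    -- the scaling ε_x
    (ε : ℝ → ℝ) (hε : ∀ x > 0, 0 < ε x)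
    (hε0 : Tendsto ε atTop (nhds 0)) (hxε : Tendsto (fun x => x * ε x) atTop atTop) :
    -- (a) upper bound for closed sets
    (∀ F : Set ℝ, IsClosed F →
      limsup (fun x : ℝ => ((ε x : ℝ) : EReal) *
          ENNReal.log (ν x {y | (y - ∫ t, t ∂(ν x)) / Real.sqrt (x / ε x) ∈ F})) atTop
        ≤ -((⨅ z ∈ F, ENNReal.ofReal (z ^ 2 * (l - m) ^ 3 / (16 * l * m)) : ℝ≥0∞) : EReal))
    -- (b) lower bound for open sets
    ∧ (∀ G : Set ℝ, IsOpen G →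
      -((⨅ z ∈ G, ENNReal.ofReal (z ^ 2 * (l - m) ^ 3 / (16 * l * m)) : ℝ≥0∞) : EReal)
        ≤ liminf (fun x : ℝ => ((ε x : ℝ) : EReal) *
            ENNReal.log (ν x {y | (y - ∫ t, t ∂(ν x)) / Real.sqrt (x / ε x) ∈ G})) atTop) := by
  have hl : 0 < l := hm.trans hlm
  have ha : 0 < l - m := sub_pos.2 hlm
  set H : ℝ → ℝ := fun s => mgf (fun θ => (M θ : ℝ)) Q (Real.log (Gzero s l m)) with hHdef
  set φ : ℝ → ℝ := fun s => 4 * (l + m) * (l + m - s)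
          / ((l - m) * (l - m + Real.sqrt ((l + m - 2 * s) ^ 2 - 4 * l * m)) ^ 2)
        - 2 / (l - m + Real.sqrt ((l + m - 2 * s) ^ 2 - 4 * l * m)) with hφdef
  have hMr : Measurable fun θ => (M θ : ℝ) := measurable_from_top.comp hMmeas
  obtain ⟨r, hr, hrM⟩ := hcond
  have h0 : (0 : ℝ) ∈ interior (integrableExpSet (fun θ => (M θ : ℝ)) Q) :=
    zero_mem_interior_integrableExpSet_of_nonneg hMr (fun θ => Nat.cast_nonneg _) hr hrM
  have hG0 : Real.log (Gzero 0 l m) = 0 := by rw [Gzero_zero hlm hm, Real.log_one]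
  have hG : DifferentiableAt ℝ (fun s => Real.log (Gzero s l m)) 0 :=
    (differentiableAt_Gzero hlm).log (by rw [Gzero_zero hlm hm]; exact one_ne_zero)
  have hH : DifferentiableAt ℝ H 0 := by
    refine DifferentiableAt.comp (0 : ℝ) (g := mgf (fun θ => (M θ : ℝ)) Q) ?_ hG
    rw [hG0]
    exact differentiableAt_mgf h0
  have hH0 : H 0 = 1 := by simp only [hHdef, hG0, mgf_zero]
  have hmgf : ∀ᶠ s in nhds 0, ∀ x > 0, ∫⁻ y, ENNReal.ofReal (Real.exp (s * y)) ∂(ν x)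
      = ENNReal.ofReal (H s * Real.exp (x * Lam s l m)) := by
    have hint : ∀ᶠ s in nhds 0,
        Real.log (Gzero s l m) ∈ interior (integrableExpSet (fun θ => (M θ : ℝ)) Q) :=
      hG.continuousAt.eventually (show _ ∈ nhds (Real.log (Gzero 0 l m)) by
        rw [hG0]; exact isOpen_interior.mem_nhds h0)
    filter_upwards [hint, eventually_le_nhds (sStar_pos hlm hm)] with s hs hsS x hx
    have hsi : Integrable (fun θ => Real.exp (Real.log (Gzero s l m) * (M θ : ℝ))) Q :=
      (interior_subset hs :
        Real.log (Gzero s l m) ∈ integrableExpSet (fun θ => (M θ : ℝ)) Q)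
    rw [hmgf_le x hx s hsS, ← ofReal_integral_eq_lintegral_ofReal hsi
      (Eventually.of_forall fun y => (Real.exp_pos _).le),
      ENNReal.ofReal_mul (mgf_nonneg)]
    rfl
  have hL : ∀ᶠ s in nhds 0, Lam s l m = (l + m) / (l - m) * s + s ^ 2 * φ s := by
    have hc : ContinuousAt (fun s : ℝ => (l + m - 2 * s) ^ 2 - 4 * l * m) 0 := by fun_prop
    filter_upwards [hc.eventually_const_lt (discriminant_zero_pos hlm)] with s hs
    exact Lam_eq_linear_add_sq_mul hlm hs.le
  have hφ : ContinuousAt φ 0 := by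
    have h1 : (l - m + Real.sqrt ((l + m - 2 * 0) ^ 2 - 4 * l * m)) ≠ 0 := by positivity
    have h2 : (l - m) * (l - m + Real.sqrt ((l + m - 2 * 0) ^ 2 - 4 * l * m)) ^ 2 ≠ 0 := by
      positivity
    fun_prop (disch := assumption)
  have hφ0 : 2 * φ 0 = 8 * l * m / (l - m) ^ 3 := by
    simp only [hφdef]
    rw [sqrt_discriminant_zero hlm]
    field_simp
    ring
  have hv : 0 < 2 * φ 0 := by rw [hφ0]; positivity
  have hrate : ∀ z : ℝ, z ^ 2 * (l - m) ^ 3 / (16 * l * m) = z ^ 2 / (2 * (2 * φ 0)) := by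
    intro z
    rw [hφ0]
    field_simp
    ring
  have hA := exists_tendsto_lintegral_exp_scaled hmgf hH hH0 hL hφ hε hε0 hxε
  have hZ : ∀ x, Measurable fun y => (y - ∫ t, t ∂(ν x)) / Real.sqrt (x / ε x) := by fun_prop
  have he : ∀ᶠ x in atTop, 0 < ε x := (eventually_gt_atTop 0).mono hε
  simp_rw [hrate]
  exact ⟨fun F _ => limsup_mul_log_le_of_quadratic hv hZ he hε0 hA F,
    fun G hG => le_liminf_mul_log_of_quadratic hv hZ he hε0 hA hG⟩
end

section
/- Let β > 1, x > 0, and let M satisfy Condition (*) with s_M ≥ log√β. For each μ > 0 let ν_μ be a Borel probability measure on [0,∞) with ∫ e^{sy} ν_μ(dy) = G_M(log G₀(s;βμ,μ))·e^{xΛ(s;βμ,μ)} (an equality in (0,∞]) for every s ≤ s*(βμ,μ), and ∫ e^{sy} ν_μ(dy) = ∞ for every s > s*(βμ,μ). Define I₂(z) := (1/2)·(√((z/x−1)β·x·x)/x ... explicitly I₂(z) := (x/2)·(√((z/x − 1)β) − √(z/x + 1))² for z ≥ x and I₂(z) := +∞ for z < x. Then: (a) for every closed set F ⊆ ℝ,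 limsup_{μ→∞} (1/μ)·log ν_μ(F) ≤ −inf_{z∈F} I₂(z); (b) for every open set G ⊆ ℝ, liminf_{μ→∞} (1/μ)·log ν_μ(G) ≥ −inf_{z∈G} I₂(z); (c) I₂ is lower semicontinuous with compact sublevel sets. -/
open MeasureTheory ProbabilityTheory Filter
open scoped ENNReal

/-- The finite part of the rate function `I₂`. -/
noncomputable def rateFn (β x z : ℝ) : ℝ :=
  x / 2 * (Real.sqrt ((z / x - 1) * β) - Real.sqrt (z / x + 1)) ^ 2

lemma continuous_rateFn (β x : ℝ) : Continuous (rateFn β x) := by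
  unfold rateFn; fun_prop

lemma rateFn_nonneg {β x : ℝ} (hx : 0 < x) (z : ℝ) : 0 ≤ rateFn β x z := by
  unfold rateFn; positivity

lemma sStar_one {β : ℝ} (hβ : 1 < β) : sStar β 1 = (β + 1) / 2 - √β := by
  have := Real.sq_sqrt (show 0 ≤ β by linarith)
  simp only [sStar, Real.sqrt_one]
  nlinarith

lemma sStar_one_pos {β : ℝ} (hβ : 1 < β) : 0 < sStar β 1 := by
  have : 1 < √β := by rw [Real.lt_sqrt] <;> linarith
  have : 0 < √β - 1 := by linarith
  simp only [sStar, Real.sqrt_one]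
  positivity

lemma sStar_smul {β u : ℝ} (hβ : 1 < β) (hu : 0 < u) : sStar (β * u) u = u * sStar β 1 := by
  have := Real.sq_sqrt hu.le
  simp only [sStar, Real.sqrt_one]
  rw [Real.sqrt_mul (by linarith)]
  linear_combination ((√β - 1) ^ 2 / 2) * this

lemma sqrt_discrim_smul {β u : ℝ} (hu : 0 < u) (s : ℝ) :
    √((β * u + u - 2 * (u * s)) ^ 2 - 4 * (β * u) * u)
      = u * √((β + 1 - 2 * s) ^ 2 - 4 * β * 1) := by
  rw [show (β * u + u - 2 * (u * s)) ^ 2 - 4 * (β * u) * u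
    = u ^ 2 * ((β + 1 - 2 * s) ^ 2 - 4 * β * 1) by ring, Real.sqrt_mul (by positivity),
    Real.sqrt_sq hu.le]

lemma Gzero_smul {β u : ℝ} (hu : 0 < u) (s : ℝ) :
    Gzero (u * s) (β * u) u = Gzero s β 1 := by
  simp only [Gzero, sqrt_discrim_smul hu]
  field_simp

lemma Lam_smul {β u : ℝ} (hu : 0 < u) (s : ℝ) :
    Lam (u * s) (β * u) u = u * Lam s β 1 := by
  simp only [Lam, sqrt_discrim_smul hu]
  ring

lemma Gzero_pos_lt {β s : ℝ} (hβ : 1 < β) (hs : s < sStar β 1) :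
    0 < Gzero s β 1 ∧ Gzero s β 1 < √β := by
  rw [sStar_one hβ] at hs
  have hb := Real.sq_sqrt (show 0 ≤ β by linarith)
  have hb0 : 0 < √β := Real.sqrt_pos.2 (by linarith)
  have hW : 2 * √β < β + 1 - 2 * s := by linarith
  simp only [Gzero]
  generalize β + 1 - 2 * s = W at *
  have h1 : √(W ^ 2 - 4 * β * 1) < W := by
    rw [Real.sqrt_lt' (by linarith)]; linarith
  have h2 : W - 2 * √β < √(W ^ 2 - 4 * β * 1) := by
    rw [Real.lt_sqrt (by linarith)]; nlinarith
  constructor <;> linarith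

/-- The Fenchel–Young inequality between `x·Λ` and the rate function. -/
lemma mul_sub_Lam_le_rateFn {β x s z : ℝ} (hβ : 1 < β) (hx : 0 < x) (hz : x ≤ z)
    (hs : s ≤ sStar β 1) : s * z - x * Lam s β 1 ≤ rateFn β x z := by
  rw [sStar_one hβ] at hs
  have hb := Real.sq_sqrt (show 0 ≤ β by linarith)
  have hb0 : 0 < √β := Real.sqrt_pos.2 (by linarith)
  obtain ⟨w, rfl⟩ : ∃ w, z = x * w := ⟨z / x, by field_simp⟩
  have hw : 1 ≤ w := by nlinarith
  have hxw : x * w / x = w := by field_simp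
  simp only [rateFn, Lam, hxw]
  rw [mul_comm (w - 1), Real.sqrt_mul (by linarith)]
  have hp := Real.sq_sqrt (show 0 ≤ w - 1 by linarith)
  have hq := Real.sq_sqrt (show 0 ≤ w + 1 by linarith)
  have hp0 := Real.sqrt_nonneg (w - 1)
  have hq0 := Real.sqrt_nonneg (w + 1)
  have hR := Real.sq_sqrt (show 0 ≤ (β + 1 - 2 * s) ^ 2 - 4 * β * 1 by nlinarith)
  have hR0 := Real.sqrt_nonneg ((β + 1 - 2 * s) ^ 2 - 4 * β * 1)
  set R := √((β + 1 - 2 * s) ^ 2 - 4 * β * 1)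
  set p := √(w - 1)
  set q := √(w + 1)
  set b := √β
  have hk : (p * q) ^ 2 = w ^ 2 - 1 := by rw [mul_pow, hp, hq]; ring
  have key : R + 2 * b * (p * q) ≤ (β + 1 - 2 * s) * w := by
    refine le_of_sq_le_sq ?_ (by nlinarith)
    have h1 : ((β + 1 - 2 * s) * w) ^ 2 - (R + 2 * b * (p * q)) ^ 2
        = (R * (p * q) - 2 * b) ^ 2 := by
      have hW : (β + 1 - 2 * s) ^ 2 = R ^ 2 + 4 * b ^ 2 := by rw [hR, hb]; ring
      rw [mul_pow, hW]
      linear_combination (-(R ^ 2 + 4 * b ^ 2)) * hk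
    nlinarith [sq_nonneg (R * (p * q) - 2 * b)]
  have h2 : (b * p - q) ^ 2 = β * (w - 1) + (w + 1) - 2 * b * (p * q) := by
    rw [← hb, ← hp, ← hq]; ring
  rw [h2]
  nlinarith

lemma hasDerivAt_Lam {β s : ℝ} (hβ : 1 < β) (hs : s < sStar β 1) :
    HasDerivAt (fun t => Lam t β 1)
      ((β + 1 - 2 * s) / √((β + 1 - 2 * s) ^ 2 - 4 * β * 1)) s := by
  rw [sStar_one hβ] at hs
  have hb := Real.sq_sqrt (show 0 ≤ β by linarith)
  have hb0 : 0 < √β := Real.sqrt_pos.2 (by linarith)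
  have hpos : 0 < (β + 1 - 2 * s) ^ 2 - 4 * β * 1 := by nlinarith
  have h1 : HasDerivAt (fun t : ℝ => (β + 1 - 2 * t) ^ 2 - 4 * β * 1)
      (2 * (β + 1 - 2 * s) * (-2)) s := by
    have := ((((hasDerivAt_id s).const_mul 2).const_sub (β + 1)).pow 2).sub_const (4 * β * 1)
    exact this.congr_deriv (by simp)
  have h2 := ((h1.sqrt hpos.ne').const_sub (β - 1)).div_const 2
  have := Real.sqrt_pos.2 hpos
  exact h2.congr_deriv (by field_simp)

/-- Above `x` the supremum defining the rate function is attained, at the point where the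
derivative of `x·Λ` equals `z`. -/
lemma exists_rateFn_eq {β x z : ℝ} (hβ : 1 < β) (hx : 0 < x) (hz : x < z) :
    ∃ s < sStar β 1, s * z - x * Lam s β 1 = rateFn β x z ∧
      HasDerivAt (fun t => Lam t β 1) (z / x) s := by
  have hb := Real.sq_sqrt (show 0 ≤ β by linarith)
  have hb0 : 0 < √β := Real.sqrt_pos.2 (by linarith)
  obtain ⟨w, rfl⟩ : ∃ w, z = x * w := ⟨z / x, by field_simp⟩
  have hw : 1 < w := by nlinarith
  have hxw : x * w / x = w := by field_simp
  have hp := Real.sq_sqrt (show 0 ≤ w - 1 by linarith)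
  have hq := Real.sq_sqrt (show 0 ≤ w + 1 by linarith)
  have hp0 : 0 < √(w - 1) := Real.sqrt_pos.2 (by linarith)
  have hq0 : 0 < √(w + 1) := Real.sqrt_pos.2 (by linarith)
  have hk : (√(w - 1) * √(w + 1)) ^ 2 = w ^ 2 - 1 := by rw [mul_pow, hp, hq]; ring
  have hk0 : 0 < √(w - 1) * √(w + 1) := by positivity
  set k := √(w - 1) * √(w + 1) with hkdef
  have hkw : k < w := by nlinarith
  obtain ⟨W, hW⟩ : ∃ W, W = 2 * √β * w / k := ⟨_, rfl⟩
  have hWk : W * k = 2 * √β * w := by rw [hW]; field_simp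
  have hWb : 2 * √β < W := by
    rw [hW, lt_div_iff₀ hk0]; nlinarith
  have hs : (β + 1 - W) / 2 < sStar β 1 := by rw [sStar_one hβ]; linarith
  have hWs : β + 1 - 2 * ((β + 1 - W) / 2) = W := by ring
  have hR : √(W ^ 2 - 4 * β * 1) = 2 * √β / k := by
    rw [show W ^ 2 - 4 * β * 1 = (2 * √β / k) ^ 2 by
      rw [hW]; field_simp; rw [hb, hk]; ring, Real.sqrt_sq (by positivity)]
  refine ⟨(β + 1 - W) / 2, hs, ?_, ?_⟩
  · simp only [rateFn, Lam, hxw, hWs, hR]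
    rw [mul_comm (w - 1), Real.sqrt_mul (by linarith)]
    have h2 : (√β * √(w - 1) - √(w + 1)) ^ 2 = β * (w - 1) + (w + 1) - 2 * √β * k := by
      rw [hkdef]
      linear_combination (√(w-1))^2 * hb + β * hp + hq
    have h3 : W * w - 2 * √β / k = 2 * √β * k := by
      rw [hW]; field_simp; rw [hk]; 
    rw [h2, ← h3]
    ring
  · convert hasDerivAt_Lam hβ hs using 1
    rw [hWs, hR, hxw, hW]
    field_simp

lemma le_mul_sub_Lam {β x z W : ℝ} (hβ : 1 < β) (hx : 0 < x) (hW : 2 * √β ≤ W) :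
    (z * (β + 1) - x * (β - 1) + (x - z) * W - 4 * β * x / W) / 2
      ≤ (β + 1 - W) / 2 * z - x * Lam ((β + 1 - W) / 2) β 1 := by
  have hb := Real.sq_sqrt (show 0 ≤ β by linarith)
  have hb0 : 0 < √β := Real.sqrt_pos.2 (by linarith)
  have hW0 : 0 < W := by linarith
  have hWs : β + 1 - 2 * ((β + 1 - W) / 2) = W := by ring
  have h : W - 4 * β / W ≤ √(W ^ 2 - 4 * β * 1) := by
    apply Real.le_sqrt_of_sq_le
    have h1 : (4 * β / W) * W = 4 * β := by field_simp
    have h2 : 0 < 4 * β / W := by positivity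
    have h3 : 4 * β / W ≤ W := by
      rw [div_le_iff₀ hW0]; nlinarith
    nlinarith
  simp only [Lam, hWs]
  have h4 := mul_le_mul_of_nonneg_left h hx.le
  have h5 : 4 * β * x / W = x * (4 * β / W) := by ring
  rw [h5]
  nlinarith

lemma exists_lt_mul_sub_Lam {β x z c : ℝ} (hβ : 1 < β) (hx : 0 < x)
    (hc : x ≤ z → c < rateFn β x z) : ∃ s < sStar β 1, c < s * z - x * Lam s β 1 := by
  rcases lt_or_ge x z with hz | hz
  · obtain ⟨s, hs, h, -⟩ := exists_rateFn_eq hβ hx hz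
    exact ⟨s, hs, h ▸ hc hz.le⟩
  have hlim : ∀ᶠ W : ℝ in atTop,
      c < (z * (β + 1) - x * (β - 1) + (x - z) * W - 4 * β * x / W) / 2 := by
    have h0 : Tendsto (fun W : ℝ => 4 * β * x / W) atTop (nhds 0) :=
      tendsto_const_nhds.div_atTop tendsto_id
    rcases hz.lt_or_eq with hz | rfl
    · have h1 : Tendsto (fun W : ℝ => (x - z) * W) atTop atTop :=
        tendsto_id.const_mul_atTop (by linarith)
      have h2 := ((tendsto_atTop_add_const_left _ (z * (β + 1) - x * (β - 1)) h1).atTop_add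
        h0.neg).atTop_div_const (show (0 : ℝ) < 2 by norm_num)
      filter_upwards [h2.eventually_gt_atTop c] with W hW
      simpa [sub_eq_add_neg] using hW
    · have hr : rateFn β z z = z := by
        simp only [rateFn, div_self hx.ne']
        norm_num
      have h2 := (h0.const_sub (z * 2)).div_const 2
      have h3 : c < (z * 2 - 0) / 2 := by
        have := hc le_rfl
        rw [hr] at this; linarith
      filter_upwards [h2.eventually_const_lt h3] with W hW
      linarith
  obtain ⟨W, hW, hWb⟩ := (hlim.and (eventually_gt_atTop (2 * √β))).exists
  refine ⟨(β + 1 - W) / 2, ?_, hW.trans_le (le_mul_sub_Lam hβ hx hWb.le)⟩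
  rw [sStar_one hβ]; linarith

lemma exists_rateFn_eq_zero {β x : ℝ} (hβ : 1 < β) (hx : 0 < x) :
    ∃ z, x < z ∧ rateFn β x z = 0 := by
  have h : 0 < β - 1 := by linarith
  refine ⟨x * ((β + 1) / (β - 1)), ?_, ?_⟩
  · rw [lt_mul_iff_one_lt_right hx, lt_div_iff₀ h]; linarith
  · have : x * ((β + 1) / (β - 1)) / x = (β + 1) / (β - 1) := by field_simp
    simp only [rateFn, this]
    rw [show ((β + 1) / (β - 1) - 1) * β = (β + 1) / (β - 1) + 1 by field_simp; ring]
    simp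

lemma tendsto_log_mul_exp_div (K c : ℝ) :
    Tendsto (fun u : ℝ => ((u⁻¹ * Real.log K - c : ℝ) : EReal)) atTop (nhds ((-c : ℝ) : EReal)) := by
  refine (continuous_coe_real_ereal.tendsto _).comp ?_
  have := (tendsto_inv_atTop_zero (𝕜 := ℝ)).mul_const (Real.log K)
  simpa using this.sub_const c

lemma inv_mul_log_ofReal {K u : ℝ} (hK : 0 < K) (hu : 0 < u) (c : ℝ) :
    ((u⁻¹ : ℝ) : EReal) * ENNReal.log (ENNReal.ofReal (K * Real.exp (-(u * c))))
      = ((u⁻¹ * Real.log K - c : ℝ) : EReal) := by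
  rw [ENNReal.log_ofReal_of_pos (by positivity), ← EReal.coe_mul,
    Real.log_mul hK.ne' (Real.exp_pos _).ne', Real.log_exp]
  congr 1
  field_simp
  ring

lemma limsup_inv_mul_log_le {m : ℝ → ℝ≥0∞} {K c : ℝ} (hK : 0 < K)
    (h : ∀ᶠ u in atTop, m u ≤ ENNReal.ofReal (K * Real.exp (-(u * c)))) :
    limsup (fun u : ℝ => ((u⁻¹ : ℝ) : EReal) * ENNReal.log (m u)) atTop ≤ ((-c : ℝ) : EReal) := by
  rw [← (tendsto_log_mul_exp_div K c).limsup_eq]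
  refine limsup_le_limsup ?_
  filter_upwards [h, eventually_gt_atTop 0] with u h hu
  rw [← inv_mul_log_ofReal hK hu]
  exact mul_le_mul_of_nonneg_left (ENNReal.log_monotone h)
    (EReal.coe_nonneg.2 (inv_nonneg.2 hu.le))

lemma le_liminf_inv_mul_log {m : ℝ → ℝ≥0∞} {K c : ℝ} (hK : 0 < K)
    (h : ∀ᶠ u in atTop, ENNReal.ofReal (K * Real.exp (-(u * c))) ≤ m u) :
    ((-c : ℝ) : EReal) ≤ liminf (fun u : ℝ => ((u⁻¹ : ℝ) : EReal) * ENNReal.log (m u)) atTop := by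
  rw [← (tendsto_log_mul_exp_div K c).liminf_eq]
  refine liminf_le_liminf ?_
  filter_upwards [h, eventually_gt_atTop 0] with u h hu
  rw [← inv_mul_log_ofReal hK hu]
  exact mul_le_mul_of_nonneg_left (ENNReal.log_monotone h)
    (EReal.coe_nonneg.2 (inv_nonneg.2 hu.le))

/-- Exponential Markov inequality under an exponential tilt. -/
lemma setLIntegral_exp_le (m : Measure ℝ) {r s a u D : ℝ} (hu : 0 ≤ u) {S : Set ℝ}
    (hS : MeasurableSet S) (h : ∀ y ∈ S, 0 ≤ (s - r) * (y - a))
    (hD : ∫⁻ y, ENNReal.ofReal (Real.exp (u * s * y)) ∂m = ENNReal.ofReal D) :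
    ∫⁻ y in S, ENNReal.ofReal (Real.exp (u * r * y)) ∂m
      ≤ ENNReal.ofReal (D * Real.exp (-(u * ((s - r) * a)))) := by
  calc ∫⁻ y in S, ENNReal.ofReal (Real.exp (u * r * y)) ∂m
      ≤ ∫⁻ y in S, ENNReal.ofReal (Real.exp (u * s * y)) *
          ENNReal.ofReal (Real.exp (-(u * ((s - r) * a)))) ∂m := by
        refine setLIntegral_mono' hS fun y hy => ?_
        rw [← ENNReal.ofReal_mul (Real.exp_nonneg _), ← Real.exp_add]
        refine ENNReal.ofReal_le_ofReal (Real.exp_le_exp.2 ?_)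
        nlinarith [mul_nonneg hu (h y hy)]
    _ ≤ ∫⁻ y, ENNReal.ofReal (Real.exp (u * s * y)) *
          ENNReal.ofReal (Real.exp (-(u * ((s - r) * a)))) ∂m := setLIntegral_le_lintegral _ _
    _ = ENNReal.ofReal (D * Real.exp (-(u * ((s - r) * a)))) := by
        rw [lintegral_mul_const' _ _ ENNReal.ofReal_ne_top, hD,
          ← ENNReal.ofReal_mul' (Real.exp_nonneg _)]

/-- `ν u` has exponential moments of order `u·s`, `s < s*`, equal to `exp (u·x·Λ(s))` up to a
constant. -/
def HasExpMoments (β x : ℝ) (ν : ℝ → Measure ℝ) : Prop :=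
  ∀ s < sStar β 1, ∃ C > 0, ∀ u > 0, ∫⁻ y, ENNReal.ofReal (Real.exp (u * s * y)) ∂(ν u)
    = ENNReal.ofReal (C * Real.exp (u * (x * Lam s β 1)))

lemma HasExpMoments.upper_bound {β x c : ℝ} {ν : ℝ → Measure ℝ} (hν : HasExpMoments β x ν)
    (hβ : 1 < β) (hx : 0 < x) (hprob : ∀ u > 0, IsProbabilityMeasure (ν u))
    {F : Set ℝ} (hF : IsClosed F) (hc : ∀ z ∈ F, x ≤ z → c < rateFn β x z) :
    ∃ K > 0, ∀ u > 0, ν u F ≤ ENNReal.ofReal (K * Real.exp (-(u * c))) := by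
  rcases lt_or_ge c 0 with hc0 | hc0
  · refine ⟨1, one_pos, fun u hu => ?_⟩
    have := hprob u hu
    refine prob_le_one.trans ?_
    rw [ENNReal.one_le_ofReal, one_mul, Real.one_le_exp_iff]
    nlinarith
  obtain ⟨z₀, hxz, hz₀⟩ := exists_rateFn_eq_zero hβ hx
  have hz₀F : z₀ ∉ F := fun h => by linarith [hc z₀ h hxz.le]
  have piece : ∀ a ∈ F, ∃ K > 0, ∀ u > 0,
      ν u {y | 0 ≤ (a - z₀) * (y - a)} ≤ ENNReal.ofReal (K * Real.exp (-(u * c))) := by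
    intro a ha
    obtain ⟨s, hs, hcs⟩ := exists_lt_mul_sub_Lam hβ hx (hc a ha)
    have hy := mul_sub_Lam_le_rateFn hβ hx hxz.le hs.le
    have hsa : 0 < s * (a - z₀) := by nlinarith
    obtain ⟨C, hC, hCu⟩ := hν s hs
    refine ⟨C, hC, fun u hu => ?_⟩
    have hm : MeasurableSet {y | 0 ≤ (a - z₀) * (y - a)} :=
      measurableSet_le measurable_const (by fun_prop)
    have := setLIntegral_exp_le (ν u) (r := 0) (s := s) (a := a) hu.le hm ?_ (hCu u hu)
    · simp only [mul_zero, zero_mul, Real.exp_zero, ENNReal.ofReal_one, lintegral_const,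
        Measure.restrict_apply, MeasurableSet.univ, Set.univ_inter, one_mul, sub_zero] at this
      refine this.trans (ENNReal.ofReal_le_ofReal ?_)
      rw [mul_assoc, ← Real.exp_add]
      refine mul_le_mul_of_nonneg_left (Real.exp_le_exp.2 ?_) hC.le
      nlinarith
    · intro y hy
      have ha0 : 0 < (a - z₀) ^ 2 := by
        have : a - z₀ ≠ 0 := fun h => by simp [h] at hsa
        positivity
      have h1 : 0 ≤ (s * (a - z₀)) * ((a - z₀) * (y - a)) := mul_nonneg hsa.le hy
      rw [sub_zero]
      refine nonneg_of_mul_nonneg_left (b := (a - z₀) ^ 2) ?_ ha0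
      linarith
  have left : ∃ K > 0, ∀ u > 0,
      ν u (F ∩ Set.Iic z₀) ≤ ENNReal.ofReal (K * Real.exp (-(u * c))) := by
    rcases (F ∩ Set.Iic z₀).eq_empty_or_nonempty with h | h
    · exact ⟨1, one_pos, fun u _ => by simp [h]⟩
    have hbdd : BddAbove (F ∩ Set.Iic z₀) := ⟨z₀, fun y hy => hy.2⟩
    have ha := (hF.inter isClosed_Iic).csSup_mem h hbdd
    obtain ⟨K, hK, hKu⟩ := piece _ ha.1
    refine ⟨K, hK, fun u hu => (measure_mono fun y hy => ?_).trans (hKu u hu)⟩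
    exact mul_nonneg_of_nonpos_of_nonpos (sub_nonpos.2 ha.2) (sub_nonpos.2 (le_csSup hbdd hy))
  have right : ∃ K > 0, ∀ u > 0,
      ν u (F ∩ Set.Ici z₀) ≤ ENNReal.ofReal (K * Real.exp (-(u * c))) := by
    rcases (F ∩ Set.Ici z₀).eq_empty_or_nonempty with h | h
    · exact ⟨1, one_pos, fun u _ => by simp [h]⟩
    have hbdd : BddBelow (F ∩ Set.Ici z₀) := ⟨z₀, fun y hy => hy.2⟩
    have ha := (hF.inter isClosed_Ici).csInf_mem h hbdd
    obtain ⟨K, hK, hKu⟩ := piece _ ha.1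
    refine ⟨K, hK, fun u hu => (measure_mono fun y hy => ?_).trans (hKu u hu)⟩
    exact mul_nonneg (sub_nonneg.2 ha.2) (sub_nonneg.2 (csInf_le hbdd hy))
  obtain ⟨K₁, hK₁, h₁⟩ := left
  obtain ⟨K₂, hK₂, h₂⟩ := right
  refine ⟨K₁ + K₂, add_pos hK₁ hK₂, fun u hu => ?_⟩
  calc ν u F ≤ ν u (F ∩ Set.Iic z₀) + ν u (F ∩ Set.Ici z₀) := by
        refine (measure_mono fun y hy => ?_).trans (measure_union_le _ _)
        exact (le_total y z₀).imp (⟨hy, ·⟩) (⟨hy, ·⟩)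
    _ ≤ _ := by
        rw [add_mul, ENNReal.ofReal_add (by positivity) (by positivity)]
        exact add_le_add (h₁ u hu) (h₂ u hu)

/-- Under the tilt whose mean is `z`, the mass beyond `z + σ` is negligible. -/
lemma HasExpMoments.tilted_tail {β x s z σ ε : ℝ} {ν : ℝ → Measure ℝ}
    (hν : HasExpMoments β x ν) (hx : 0 < x) (hs : s < sStar β 1)
    (hderiv : HasDerivAt (fun t => Lam t β 1) (z / x) s) (hσ : σ ≠ 0) (hε : 0 < ε) :
    ∀ᶠ u in atTop, ∫⁻ y in {y | 0 ≤ σ * (y - (z + σ))}, ENNReal.ofReal (Real.exp (u * s * y)) ∂(ν u)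
      ≤ ENNReal.ofReal (ε * Real.exp (u * (x * Lam s β 1))) := by
  obtain ⟨τ, hτ, hτs, hτpos⟩ : ∃ τ > 0, s + σ * τ < sStar β 1 ∧
      0 < (σ * τ) * (z + σ) - (x * Lam (s + σ * τ) β 1 - x * Lam s β 1) := by
    have hlin : HasDerivAt (fun τ : ℝ => s + σ * τ) σ 0 := by
      simpa using ((hasDerivAt_id (0 : ℝ)).const_mul σ).const_add s
    have h1 : HasDerivAt (fun τ : ℝ => Lam (s + σ * τ) β 1) (z / x * σ) 0 :=
      HasDerivAt.comp (h₂ := fun t => Lam t β 1) 0 (by simpa using hderiv) hlin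
    have h2 : HasDerivAt (fun τ : ℝ => σ * τ * (z + σ) - x * Lam (s + σ * τ) β 1) (σ ^ 2) 0 := by
      refine ((((hasDerivAt_id (0 : ℝ)).const_mul σ).mul_const (z + σ)).sub
        (h1.const_mul x)).congr_deriv ?_
      field_simp
      ring
    have h3 := h2.tendsto_slope_zero_right.eventually_const_lt (by positivity : 0 < σ ^ 2)
    have h4 : ∀ᶠ τ in nhdsWithin (0 : ℝ) (Set.Ioi 0), s + σ * τ < sStar β 1 :=
      (hlin.continuousAt.eventually_lt continuousAt_const (by simpa using hs)).filter_mono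
        nhdsWithin_le_nhds
    obtain ⟨τ, ⟨h3, h4⟩, hτ⟩ := ((h3.and h4).and self_mem_nhdsWithin).exists
    have hτ' : 0 < τ := hτ
    refine ⟨τ, hτ', h4, ?_⟩
    simp only [zero_add, mul_zero, zero_mul, add_zero, smul_eq_mul] at h3
    have := pos_of_mul_pos_right h3 (inv_nonneg.2 hτ'.le)
    linarith
  obtain ⟨C, hC, hCu⟩ := hν _ hτs
  set η := (σ * τ) * (z + σ) - (x * Lam (s + σ * τ) β 1 - x * Lam s β 1) with hη
  have hlim : Tendsto (fun u : ℝ => C * Real.exp (-(u * η))) atTop (nhds 0) := by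
    have := (Real.tendsto_exp_neg_atTop_nhds_zero.comp
      (tendsto_id.atTop_mul_const hτpos)).const_mul C
    simpa using this
  filter_upwards [hlim.eventually_le_const hε, eventually_gt_atTop 0] with u hu hu0
  have hm : MeasurableSet {y | 0 ≤ σ * (y - (z + σ))} :=
    measurableSet_le measurable_const (by fun_prop)
  refine (setLIntegral_exp_le (ν u) (r := s) (a := z + σ) hu0.le hm ?_ (hCu u hu0)).trans
    (ENNReal.ofReal_le_ofReal ?_)
  · intro y hy
    have := mul_nonneg hτ.le hy
    linarith
  · rw [mul_assoc, ← Real.exp_add]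
    refine le_trans (le_of_eq ?_) (mul_le_mul_of_nonneg_right hu (Real.exp_nonneg _))
    rw [mul_assoc, ← Real.exp_add]
    congr 2
    rw [hη]
    ring

lemma HasExpMoments.lower_bound {β x z c : ℝ} {ν : ℝ → Measure ℝ} (hν : HasExpMoments β x ν)
    (hβ : 1 < β) (hx : 0 < x) (hz : x < z) (hc : rateFn β x z < c)
    {G : Set ℝ} (hG : IsOpen G) (hzG : z ∈ G) :
    ∃ K > 0, ∀ᶠ u in atTop, ENNReal.ofReal (K * Real.exp (-(u * c))) ≤ ν u G := by
  obtain ⟨s, hs, hval, hderiv⟩ := exists_rateFn_eq hβ hx hz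
  obtain ⟨ε, hε, hball⟩ := Metric.isOpen_iff.1 hG z hzG
  obtain ⟨C, hC, hCu⟩ := hν s hs
  obtain ⟨δ, hδ, hδε, hδs⟩ : ∃ δ > 0, δ ≤ ε ∧ |s| * δ ≤ c - rateFn β x z := by
    have h1 : 0 < |s| + 1 := by positivity
    have h2 : 0 < c - rateFn β x z := by linarith
    refine ⟨min ε ((c - rateFn β x z) / (|s| + 1)), by positivity, min_le_left _ _, ?_⟩
    have h3 := min_le_right ε ((c - rateFn β x z) / (|s| + 1))
    rw [le_div_iff₀ h1] at h3
    have : 0 < min ε ((c - rateFn β x z) / (|s| + 1)) := by positivity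
    linarith
  refine ⟨C / 2, by positivity, ?_⟩
  filter_upwards [hν.tilted_tail hx hs hderiv hδ.ne' (show 0 < C / 4 by positivity),
    hν.tilted_tail hx hs hderiv (neg_ne_zero.2 hδ.ne') (show 0 < C / 4 by positivity),
    eventually_gt_atTop 0] with u h₁ h₂ hu
  set f : ℝ → ℝ≥0∞ := fun y => ENNReal.ofReal (Real.exp (u * s * y))
  set T := Real.exp (u * (x * Lam s β 1)) with hT
  have hT0 : 0 < T := Real.exp_pos _
  set A := {y | 0 ≤ δ * (y - (z + δ))}
  set A' := {y | 0 ≤ -δ * (y - (z + -δ))}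
  set B := Set.Ioo (z - δ) (z + δ)
  have hBG : B ⊆ G := fun y hy => hball (by
    rw [Metric.mem_ball, Real.dist_eq, abs_lt]; constructor <;> linarith [hy.1, hy.2])
  have hcover : (Set.univ : Set ℝ) ⊆ B ∪ (A ∪ A') := by
    intro y _
    by_cases hy1 : z + δ ≤ y
    · exact Or.inr (Or.inl (mul_nonneg hδ.le (by linarith)))
    by_cases hy2 : y ≤ z - δ
    · have hyA' : 0 ≤ -δ * (y - (z + -δ)) :=
        mul_nonneg_of_nonpos_of_nonpos (by linarith) (by linarith)
      exact Or.inr (Or.inr hyA')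
    · exact Or.inl ⟨by linarith, by linarith⟩
  have hBint : ∫⁻ y in B, f y ∂(ν u)
      ≤ ENNReal.ofReal (Real.exp (u * (s * z + |s| * δ))) * ν u B := by
    rw [← setLIntegral_const]
    refine setLIntegral_mono' measurableSet_Ioo fun y hy =>
      ENNReal.ofReal_le_ofReal (Real.exp_le_exp.2 ?_)
    have h3 : |y - z| ≤ δ := abs_le.2 ⟨by linarith [hy.1], by linarith [hy.2]⟩
    have h4 : s * (y - z) ≤ |s| * δ :=
      (le_abs_self _).trans ((abs_mul _ _).trans_le (mul_le_mul_of_nonneg_left h3 (abs_nonneg s)))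
    nlinarith
  have htotal : ENNReal.ofReal (C / 2 * T) + ENNReal.ofReal (C / 2 * T)
      ≤ ENNReal.ofReal (Real.exp (u * (s * z + |s| * δ))) * ν u B
        + ENNReal.ofReal (C / 2 * T) := by
    calc ENNReal.ofReal (C / 2 * T) + ENNReal.ofReal (C / 2 * T)
        = ∫⁻ y in Set.univ, f y ∂(ν u) := by
          rw [setLIntegral_univ, hCu u hu, ← ENNReal.ofReal_add (by positivity) (by positivity)]
          congr 1
          ring
      _ ≤ ∫⁻ y in B ∪ (A ∪ A'), f y ∂(ν u) := lintegral_mono_set hcover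
      _ ≤ ∫⁻ y in B, f y ∂(ν u) + (∫⁻ y in A, f y ∂(ν u) + ∫⁻ y in A', f y ∂(ν u)) :=
          (lintegral_union_le _ _ _).trans (add_le_add le_rfl (lintegral_union_le _ _ _))
      _ ≤ _ := by
          refine add_le_add hBint ((add_le_add h₁ h₂).trans (le_of_eq ?_))
          rw [← ENNReal.ofReal_add (by positivity) (by positivity)]
          congr 1
          ring
  have hmain := (ENNReal.add_le_add_iff_right ENNReal.ofReal_ne_top).1 htotal
  calc ENNReal.ofReal (C / 2 * Real.exp (-(u * c)))
      ≤ ENNReal.ofReal (Real.exp (-(u * (s * z + |s| * δ)))) * ENNReal.ofReal (C / 2 * T) := by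
        rw [← ENNReal.ofReal_mul (Real.exp_nonneg _), mul_left_comm, hT, ← Real.exp_add]
        refine ENNReal.ofReal_le_ofReal
          (mul_le_mul_of_nonneg_left (Real.exp_le_exp.2 ?_) (by positivity))
        nlinarith
    _ ≤ ENNReal.ofReal (Real.exp (-(u * (s * z + |s| * δ)))) *
          (ENNReal.ofReal (Real.exp (u * (s * z + |s| * δ))) * ν u B) := mul_le_mul_right hmain _
    _ = ν u B := by
        rw [← mul_assoc, ← ENNReal.ofReal_mul (Real.exp_nonneg _), ← Real.exp_add]
        simp
    _ ≤ ν u G := measure_mono hBG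

lemma hasExpMoments_of_mgf {Θ : Type*} [MeasurableSpace Θ] (Q : Measure Θ)
    [IsProbabilityMeasure Q] (M : Θ → ℕ) (hMmeas : Measurable M) {β x : ℝ} (hβ : 1 < β)
    (hsM : ∀ r : ℝ, r < Real.log (Real.sqrt β) →
      ∫⁻ θ, ENNReal.ofReal (Real.exp (r * (M θ : ℝ))) ∂Q < ⊤)
    (ν : ℝ → Measure ℝ)
    (hmgf_le : ∀ u > 0, ∀ s ≤ sStar (β * u) u,
      ∫⁻ y, ENNReal.ofReal (Real.exp (s * y)) ∂(ν u)
        = (∫⁻ θ, ENNReal.ofReal (Real.exp (Real.log (Gzero s (β * u) u) * (M θ : ℝ))) ∂Q)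
            * ENNReal.ofReal (Real.exp (x * Lam s (β * u) u))) :
    HasExpMoments β x ν := by
  intro s hs
  obtain ⟨hG0, hG⟩ := Gzero_pos_lt hβ hs
  set c := ∫⁻ θ, ENNReal.ofReal (Real.exp (Real.log (Gzero s β 1) * (M θ : ℝ))) ∂Q with hc
  have hfin : c ≠ ⊤ := (hsM _ (Real.log_lt_log hG0 hG)).ne
  have hpos : c ≠ 0 := by
    rw [hc, Ne, lintegral_eq_zero_iff (by fun_prop)]
    intro h
    obtain ⟨θ, hθ⟩ := h.exists
    simp only [Pi.zero_apply, ENNReal.ofReal_eq_zero] at hθ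
    exact absurd hθ (Real.exp_pos _).not_ge
  refine ⟨c.toReal, ENNReal.toReal_pos hpos hfin, fun u hu => ?_⟩
  have hle : u * s ≤ sStar (β * u) u := by
    rw [sStar_smul hβ hu]; exact mul_le_mul_of_nonneg_left hs.le hu.le
  rw [hmgf_le u hu _ hle, Gzero_smul hu, Lam_smul hu, ENNReal.ofReal_mul ENNReal.toReal_nonneg,
    ENNReal.ofReal_toReal hfin, mul_left_comm x u]

/-- LDP for `A_x(βμ,μ)` as `μ → ∞`, Case A: `s_M ≥ log√β`, with speed `μ` and
good rate function `I₂(z) = x·H_A(z/x;β,1)`. The abscissa condition is encoded as: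
`G_M(r) < ∞` for every `r < log√β`. -/
theorem ldp_scaling2_caseA
    {Θ : Type*} [MeasurableSpace Θ] (Q : Measure Θ) [IsProbabilityMeasure Q]
    (M : Θ → ℕ) (hMmeas : Measurable M) (hM1 : ∀ θ, 1 ≤ M θ)
    (β x : ℝ) (hβ : 1 < β) (hx : 0 < x)
    -- Condition (*) with s_M ≥ log√β
    (hsM : ∀ r : ℝ, r < Real.log (Real.sqrt β) →
      ∫⁻ θ, ENNReal.ofReal (Real.exp (r * (M θ : ℝ))) ∂Q < ⊤)
    -- the laws ν_μ of the absorption times A_x(βμ,μ)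
    (ν : ℝ → Measure ℝ) (hprob : ∀ u > 0, IsProbabilityMeasure (ν u))
    (hsupp : ∀ u > 0, ν u (Set.Iio 0) = 0)
    (hmgf_le : ∀ u > 0, ∀ s ≤ sStar (β * u) u,
      ∫⁻ y, ENNReal.ofReal (Real.exp (s * y)) ∂(ν u)
        = (∫⁻ θ, ENNReal.ofReal (Real.exp (Real.log (Gzero s (β * u) u) * (M θ : ℝ))) ∂Q)
            * ENNReal.ofReal (Real.exp (x * Lam s (β * u) u)))
    (hmgf_gt : ∀ u > 0, ∀ s > sStar (β * u) u,
      ∫⁻ y, ENNReal.ofReal (Real.exp (s * y)) ∂(ν u) = ⊤)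
    -- the rate function I₂
    (I : ℝ → ℝ≥0∞)
    (hI : ∀ z : ℝ, I z = if x ≤ z then
      ENNReal.ofReal (x / 2 * (Real.sqrt ((z / x - 1) * β) - Real.sqrt (z / x + 1)) ^ 2)
      else ⊤) :
    -- (a) upper bound for closed sets
    (∀ F : Set ℝ, IsClosed F →
      limsup (fun u : ℝ => ((u⁻¹ : ℝ) : EReal) * ENNReal.log (ν u F)) atTop
        ≤ -((⨅ z ∈ F, I z : ℝ≥0∞) : EReal))
    -- (b) lower bound for open sets
    ∧ (∀ G : Set ℝ, IsOpen G →
      -((⨅ z ∈ G, I z : ℝ≥0∞) : EReal)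
        ≤ liminf (fun u : ℝ => ((u⁻¹ : ℝ) : EReal) * ENNReal.log (ν u G)) atTop)
    -- (c) goodness of the rate function
    ∧ LowerSemicontinuous I
    ∧ (∀ c : ℝ, IsCompact {z : ℝ | I z ≤ ENNReal.ofReal c}) := by
  have hν := hasExpMoments_of_mgf Q M hMmeas hβ hsM ν hmgf_le
  have hI_of_le : ∀ z, x ≤ z → I z = ENNReal.ofReal (rateFn β x z) := fun z hz => by
    rw [hI, if_pos hz]; rfl
  have hsublevel : ∀ a : ℝ≥0∞, a ≠ ⊤ →
      {z | I z ≤ a} = Set.Ici x ∩ {z | ENNReal.ofReal (rateFn β x z) ≤ a} := by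
    intro a ha
    ext z
    simp only [Set.mem_ofPred_eq, Set.mem_inter_iff, Set.mem_Ici]
    by_cases hz : x ≤ z
    · simp [hz, hI_of_le z hz]
    · simp [hI z, hz, ha]
  have hclosed : ∀ a : ℝ≥0∞, a ≠ ⊤ → IsClosed {z | I z ≤ a} := by
    intro a ha
    rw [hsublevel a ha]
    exact isClosed_Ici.inter (isClosed_le
      (ENNReal.continuous_ofReal.comp (continuous_rateFn β x)) continuous_const)
  refine ⟨fun F hF => ?_, fun G hG => ?_, ?_, fun c => ?_⟩
  · rw [EReal.le_neg]
    refine le_of_forall_lt_imp_le_of_dense fun b hb => ?_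
    obtain ⟨c, hbc, hc⟩ := EReal.lt_iff_exists_real_btwn.1 hb
    obtain ⟨K, hK, hKu⟩ := hν.upper_bound hβ hx hprob hF (c := c) fun z hz hxz => by
      have h := hc.trans_le (EReal.coe_ennreal_le_coe_ennreal_iff.2 (iInf₂_le z hz))
      rwa [hI_of_le z hxz, EReal.coe_ennreal_ofReal, max_eq_left (rateFn_nonneg hx z),
        EReal.coe_lt_coe_iff] at h
    have h := limsup_inv_mul_log_le hK ((eventually_gt_atTop 0).mono hKu)
    rw [EReal.coe_neg, ← EReal.le_neg] at h
    exact hbc.le.trans h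
  · rw [EReal.neg_le]
    refine le_of_forall_gt_imp_ge_of_dense fun b hb => ?_
    obtain ⟨c, hc, hcb⟩ := EReal.lt_iff_exists_real_btwn.1 hb
    obtain ⟨z, hzG, hz⟩ : ∃ z ∈ G, I z < ENNReal.ofReal c := by
      have h : (⨅ z ∈ G, I z) < ENNReal.ofReal c := by
        rw [← EReal.coe_ennreal_lt_coe_ennreal_iff, EReal.coe_ennreal_ofReal]
        exact hc.trans_le (EReal.coe_le_coe_iff.2 (le_max_left c 0))
      simpa [iInf_lt_iff] using h
    have hxz : x ≤ z := by
      by_contra h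
      simp [hI z, h] at hz
    rw [hI_of_le z hxz, ENNReal.ofReal_lt_ofReal_iff_of_nonneg (rateFn_nonneg hx z)] at hz
    obtain ⟨w, ⟨hwG, hwc⟩, hzw⟩ : ∃ w, (w ∈ G ∧ rateFn β x w < c) ∧ z < w := by
      have h : ∀ᶠ w in nhds z, w ∈ G ∧ rateFn β x w < c :=
        (hG.eventually_mem hzG).and
          ((continuous_rateFn β x).continuousAt.eventually_lt continuousAt_const hz)
      exact ((h.filter_mono nhdsWithin_le_nhds).and (self_mem_nhdsWithin (s := Set.Ioi z))).exists
    obtain ⟨K, hK, hKu⟩ := hν.lower_bound hβ hx (hxz.trans_lt hzw) hwc hG hwG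
    have h := le_liminf_inv_mul_log hK hKu
    rw [EReal.coe_neg, EReal.neg_le] at h
    exact h.trans hcb.le
  · rw [lowerSemicontinuous_iff_isClosed_preimage]
    intro a
    rcases eq_or_ne a ⊤ with rfl | ha
    · convert isClosed_univ
      ext z
      simp
    · exact hclosed a ha
  · have hs := sStar_one_pos hβ
    refine Metric.isCompact_of_isClosed_isBounded (hclosed _ ENNReal.ofReal_ne_top)
      ((Metric.isBounded_Icc x
        ((max c 0 + x * Lam (sStar β 1) β 1) / sStar β 1)).subset ?_)
    rw [hsublevel _ ENNReal.ofReal_ne_top]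
    rintro z ⟨hz, hzc⟩
    refine ⟨hz, ?_⟩
    have h1 : rateFn β x z ≤ max c 0 := by
      rcases ENNReal.ofReal_le_ofReal_iff'.1 hzc with h | h
      · exact h.trans (le_max_left _ _)
      · exact h.trans (le_max_right _ _)
    have h2 := mul_sub_Lam_le_rateFn hβ hx hz (le_refl (sStar β 1))
    rw [le_div_iff₀ hs]
    linarith
end

section
/- Let β > 1, x > 0, and let M satisfy Condition (*). For each μ > 0 let ν_μ be a Borel probability measure on [0,∞) with ∫ e^{sy} ν_μ(dy) = G_M(log G₀(s;βμ,μ))·e^{xΛ(s;βμ,μ)} (an equality in (0,∞]) for every s ≤ s*(βμ,μ), and ∫ e^{sy} ν_μ(dy) = ∞ for every s > s*(βμ,μ); let m_μ := ∫ y ν_μ(dy) be the mean of ν_μ. Then for every family of positive numbers (ε_μ)_{μ>0} with ε_μ → 0 and μ·ε_μ → ∞ as μ → ∞: (a) for every closed set F ⊆ ℝ, limsup_{μ→∞} ε_μ·log ν_μ({y : √(μ·ε_μ)·(y − m_μ) ∈ F}) ≤ −inf_{z∈F} z²(β−1)³/(16xβ); (b) for every open set G ⊆ ℝ, liminf_{μ→∞}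 ε_μ·log ν_μ({y : √(μ·ε_μ)·(y − m_μ) ∈ G}) ≥ −inf_{z∈G} z²(β−1)³/(16xβ). -/
open MeasureTheory ProbabilityTheory Filter
open scoped ENNReal

section GaussianLimit

variable {ι Ω : Type*} [MeasurableSpace Ω]

/-- Scaled log-probabilities inherit exponential upper bounds. -/
lemma mul_log_measure_le {P : Measure Ω} [IsFiniteMeasure P] {S : Set Ω} {e a : ℝ} (he : 0 < e)
    (h : P.real S ≤ Real.exp (a / e)) : (e : EReal) * ENNReal.log (P S) ≤ (a : EReal) := by
  have h1 : P S ≤ ENNReal.ofReal (Real.exp (a / e)) := by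
    rw [← ofReal_measureReal (measure_ne_top P S)]
    exact ENNReal.ofReal_le_ofReal h
  have h2 := ENNReal.log_le_log h1
  rw [ENNReal.log_ofReal_of_pos (Real.exp_pos _), Real.log_exp] at h2
  calc (e : EReal) * ENNReal.log (P S) ≤ (e : EReal) * ((a / e : ℝ) : EReal) :=
        mul_le_mul_of_nonneg_left h2 (by exact_mod_cast he.le)
    _ = (a : EReal) := by rw [← EReal.coe_mul, mul_div_cancel₀ _ he.ne']

/-- Scaled log-probabilities inherit exponential lower bounds. -/
lemma le_mul_log_measure {P : Measure Ω} [IsFiniteMeasure P] {S : Set Ω} {e a : ℝ} (he : 0 < e)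
    (h : Real.exp (a / e) ≤ P.real S) : (a : EReal) ≤ (e : EReal) * ENNReal.log (P S) := by
  have h1 : ENNReal.ofReal (Real.exp (a / e)) ≤ P S := by
    rw [← ofReal_measureReal (measure_ne_top P S)]
    exact ENNReal.ofReal_le_ofReal h
  have h2 := ENNReal.log_le_log h1
  rw [ENNReal.log_ofReal_of_pos (Real.exp_pos _), Real.log_exp] at h2
  calc (a : EReal) = (e : EReal) * ((a / e : ℝ) : EReal) := by
        rw [← EReal.coe_mul, mul_div_cancel₀ _ he.ne']
    _ ≤ (e : EReal) * ENNReal.log (P S) :=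
        mul_le_mul_of_nonneg_left h2 (by exact_mod_cast he.le)

/-- A family of laws whose scaled cumulant generating functions, at speed `1 / ε`, converge
pointwise to the Gaussian one `θ ↦ c θ² / 2`. -/
structure HasGaussianScaledCGF (P : ι → Measure Ω) (W : ι → Ω → ℝ) (ε : ι → ℝ) (c : ℝ)
    (l : Filter ι) : Prop where
  pos : 0 < c
  prob : ∀ᶠ u in l, IsProbabilityMeasure (P u)
  meas : ∀ u, Measurable (W u)
  speed_pos : ∀ᶠ u in l, 0 < ε u
  speed_tendsto : Tendsto ε l (nhds 0)
  integrable : ∀ θ : ℝ, ∀ᶠ u in l, Integrable (fun ω => Real.exp (θ / ε u * W u ω)) (P u)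
  tendsto : ∀ θ : ℝ, Tendsto (fun u => ε u * cgf (W u) (P u) (θ / ε u)) l (nhds (c * θ ^ 2 / 2))

namespace HasGaussianScaledCGF

variable {P : ι → Measure Ω} {W : ι → Ω → ℝ} {ε : ι → ℝ} {c : ℝ} {l : Filter ι}

lemma eventually_mgf_bounds (h : HasGaussianScaledCGF P W ε c l) (θ : ℝ) {γ : ℝ} (hγ : 0 < γ) :
    ∀ᶠ u in l, Real.exp ((c * θ ^ 2 / 2 - γ) / ε u) ≤ mgf (W u) (P u) (θ / ε u) ∧
      mgf (W u) (P u) (θ / ε u) ≤ Real.exp ((c * θ ^ 2 / 2 + γ) / ε u) := by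
  filter_upwards [h.prob, h.speed_pos, h.integrable θ,
    (h.tendsto θ).eventually (Ioo_mem_nhds (sub_lt_self _ hγ) (lt_add_of_pos_right _ hγ))]
    with u hp he hi hu
  rw [← exp_cgf hi, Real.exp_le_exp, Real.exp_le_exp, div_le_iff₀ he, le_div_iff₀ he]
  constructor <;> linarith [hu.1, hu.2]

lemma eventually_const_le_exp (h : HasGaussianScaledCGF P W ε c l) (C : ℝ) {γ : ℝ} (hγ : 0 < γ) :
    ∀ᶠ u in l, C ≤ Real.exp (γ / ε u) := by
  have h0 : Tendsto ε l (nhdsWithin 0 (Set.Ioi 0)) :=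
    tendsto_nhdsWithin_iff.2 ⟨h.speed_tendsto, h.speed_pos⟩
  have h1 : Tendsto (fun u => Real.exp (γ / ε u)) l atTop := by
    simp only [div_eq_mul_inv]
    exact Real.tendsto_exp_atTop.comp (h0.inv_tendsto_nhdsGT_zero.const_mul_atTop hγ)
  exact h1.eventually_ge_atTop C

/-- The upper bound of the large deviation principle with Gaussian rate function. -/
theorem limsup_le (h : HasGaussianScaledCGF P W ε c l) {S : Set ℝ} {R : ℝ} (hR : 0 ≤ R)
    (hS : ∀ z ∈ S, R ≤ z ^ 2 / (2 * c)) :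
    limsup (fun u => (ε u : EReal) * ENNReal.log (P u {ω | W u ω ∈ S})) l ≤ ((-R : ℝ) : EReal) := by
  have hc := h.pos
  obtain ⟨θ, hθ0, hθ⟩ : ∃ θ : ℝ, 0 ≤ θ ∧ c * θ ^ 2 / 2 = R := by
    refine ⟨√(2 * R / c), Real.sqrt_nonneg _, ?_⟩
    rw [Real.sq_sqrt (by positivity)]
    field_simp
  rw [← EReal.le_of_forall_lt_iff_le]
  intro q hq
  have hq : -R < q := by exact_mod_cast hq
  obtain ⟨γ, hγ, rfl⟩ : ∃ γ : ℝ, 0 < γ ∧ q = -R + 2 * γ := ⟨(q + R) / 2, by linarith, by ring⟩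
  refine limsup_le_of_le (by isBoundedDefault) ?_
  filter_upwards [h.prob, h.speed_pos, h.integrable θ, h.integrable (-θ),
    h.eventually_mgf_bounds θ hγ, h.eventually_mgf_bounds (-θ) hγ, h.eventually_const_le_exp 2 hγ]
    with u hp he hi1 hi2 hm1 hm2 h2
  refine mul_log_measure_le he ?_
  have hsub : {ω | W u ω ∈ S} ⊆ {ω | c * θ ≤ W u ω} ∪ {ω | W u ω ≤ -(c * θ)} := by
    intro ω hω
    have h3 := hS _ hω
    rw [le_div_iff₀ (by positivity), ← hθ] at h3
    have h4 : (c * θ) ^ 2 ≤ (W u ω) ^ 2 := by nlinarith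
    rcases le_abs.1 ((le_abs_self _).trans (sq_le_sq.1 h4)) with h5 | h5
    · exact Or.inl h5
    · exact Or.inr (le_neg.1 h5)
  have key1 := measure_ge_le_exp_mul_mgf (μ := P u) (X := W u) (c * θ)
    (div_nonneg hθ0 he.le) hi1
  have key2 := measure_le_le_exp_mul_mgf (μ := P u) (X := W u) (-(c * θ))
    (div_nonpos_of_nonpos_of_nonneg (neg_nonpos.2 hθ0) he.le) hi2
  have e1 : -(θ / ε u) * (c * θ) + (c * θ ^ 2 / 2 + γ) / ε u = (-R + γ) / ε u := by
    rw [← hθ]; field_simp; ring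
  have b1 : (P u).real {ω | c * θ ≤ W u ω} ≤ Real.exp ((-R + γ) / ε u) := by
    rw [← e1, Real.exp_add]
    exact key1.trans (by gcongr; exact hm1.2)
  have b2 : (P u).real {ω | W u ω ≤ -(c * θ)} ≤ Real.exp ((-R + γ) / ε u) := by
    have e2 : -(-θ / ε u) * -(c * θ) = -(θ / ε u) * (c * θ) := by ring
    rw [e2] at key2
    rw [← e1, Real.exp_add]
    refine key2.trans ?_
    gcongr
    simpa using hm2.2
  calc (P u).real {ω | W u ω ∈ S}
      ≤ (P u).real {ω | c * θ ≤ W u ω} + (P u).real {ω | W u ω ≤ -(c * θ)} :=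
        (measureReal_mono hsub).trans (measureReal_union_le _ _)
    _ ≤ Real.exp ((-R + γ) / ε u) * 2 := by linarith
    _ ≤ Real.exp ((-R + γ) / ε u) * Real.exp (γ / ε u) := by gcongr
    _ = Real.exp ((-R + 2 * γ) / ε u) := by rw [← Real.exp_add]; ring_nf

/-- Truncating the moment generating function to a `δ`-neighbourhood of `z`. -/
lemma mgf_le_of_window {μ : Measure Ω} [IsProbabilityMeasure μ] {X : Ω → ℝ} (hX : Measurable X)
    {a b z δ : ℝ} (hb : 0 ≤ b)
    (h0 : Integrable (fun ω => Real.exp (a * X ω)) μ)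
    (h1 : Integrable (fun ω => Real.exp ((a + b) * X ω)) μ)
    (h2 : Integrable (fun ω => Real.exp ((a - b) * X ω)) μ) :
    mgf X μ a ≤ Real.exp (a * z + |a| * δ) * μ.real {ω | |X ω - z| < δ}
      + Real.exp (-(b * δ) - b * z) * mgf X μ (a + b)
      + Real.exp (-(b * δ) + b * z) * mgf X μ (a - b) := by
  have hB : MeasurableSet {ω | |X ω - z| < δ} :=
    measurableSet_lt (hX.sub_const z).abs measurable_const
  have hint : Integrable ({ω | |X ω - z| < δ}.indicator
      (fun _ => Real.exp (a * z + |a| * δ))) μ := (integrable_const _).indicator hB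
  have e0 : Real.exp (a * z + |a| * δ) * μ.real {ω | |X ω - z| < δ}
      = ∫ ω, {ω | |X ω - z| < δ}.indicator (fun _ => Real.exp (a * z + |a| * δ)) ω ∂μ := by
    rw [integral_indicator_const _ hB, smul_eq_mul, mul_comm]
  rw [e0]
  simp only [mgf]
  have hint1 : Integrable (fun ω => {ω | |X ω - z| < δ}.indicator
      (fun _ => Real.exp (a * z + |a| * δ)) ω
        + Real.exp (-(b * δ) - b * z) * Real.exp ((a + b) * X ω)) μ := hint.add (h1.const_mul _)
  rw [← integral_const_mul, ← integral_const_mul, ← integral_add hint (h1.const_mul _),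
    ← integral_add hint1 (h2.const_mul _)]
  refine integral_mono h0 (hint1.add (h2.const_mul _)) fun ω => ?_
  simp only [← Real.exp_add]
  by_cases hω : |X ω - z| < δ
  · rw [Set.indicator_of_mem (by exact hω)]
    have h3 : a * (X ω - z) ≤ |a| * δ := by
      calc a * (X ω - z) ≤ |a * (X ω - z)| := le_abs_self _
        _ = |a| * |X ω - z| := abs_mul _ _
        _ ≤ |a| * δ := by gcongr
    have h4 : Real.exp (a * X ω) ≤ Real.exp (a * z + |a| * δ) := Real.exp_le_exp.2 (by linarith)
    linarith [Real.exp_pos (-(b * δ) - b * z + (a + b) * X ω),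
      Real.exp_pos (-(b * δ) + b * z + (a - b) * X ω)]
  · rw [Set.indicator_of_notMem (by exact hω)]
    rcases le_abs.1 (not_lt.1 hω) with h3 | h3
    · have h4 : Real.exp (a * X ω) ≤ Real.exp (-(b * δ) - b * z + (a + b) * X ω) :=
        Real.exp_le_exp.2 (by nlinarith)
      linarith [Real.exp_pos (-(b * δ) + b * z + (a - b) * X ω)]
    · have h4 : Real.exp (a * X ω) ≤ Real.exp (-(b * δ) + b * z + (a - b) * X ω) :=
        Real.exp_le_exp.2 (by nlinarith)
      linarith [Real.exp_pos (-(b * δ) - b * z + (a + b) * X ω)]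

lemma eventually_exp_le_window (h : HasGaussianScaledCGF P W ε c l) (z : ℝ) {δ γ : ℝ} (hδ : 0 < δ)
    (hγ : 0 < γ) :
    ∀ᶠ u in l, Real.exp ((-(z ^ 2 / (2 * c)) - |z / c| * δ - 2 * γ) / ε u)
      ≤ (P u).real {ω | |W u ω - z| < δ} := by
  have hc := h.pos
  obtain ⟨θ, rfl⟩ : ∃ θ, z = c * θ := ⟨z / c, by field_simp⟩
  obtain ⟨η, rfl⟩ : ∃ η, δ = c * η := ⟨δ / c, by field_simp⟩
  have hη : 0 < η := pos_of_mul_pos_right hδ hc.le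
  obtain ⟨κ, hκ, hκγ, hκη⟩ : ∃ κ, 0 < κ ∧ κ ≤ γ ∧ κ ≤ c * η ^ 2 / 8 :=
    ⟨min γ (c * η ^ 2 / 8), lt_min hγ (by positivity), min_le_left _ _, min_le_right _ _⟩
  filter_upwards [h.prob, h.speed_pos, h.integrable θ, h.integrable (θ + η), h.integrable (θ - η),
    h.eventually_mgf_bounds θ hκ, h.eventually_mgf_bounds (θ + η) hκ,
    h.eventually_mgf_bounds (θ - η) hκ, h.eventually_const_le_exp 4 hκ]
    with u hp he hi hi1 hi2 hm hm1 hm2 h4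
  have hw := mgf_le_of_window (μ := P u) (h.meas u) (a := θ / ε u) (b := η / ε u) (z := c * θ)
    (δ := c * η) (by positivity) hi (by rwa [← add_div]) (by rwa [← sub_div])
  rw [← add_div, ← sub_div] at hw
  set E := Real.exp ((c * θ ^ 2 / 2 - κ) / ε u)
  have small : 4 * Real.exp ((c * θ ^ 2 / 2 - 3 * κ) / ε u) ≤ E := by
    calc 4 * Real.exp ((c * θ ^ 2 / 2 - 3 * κ) / ε u)
        ≤ Real.exp (κ / ε u) * Real.exp ((c * θ ^ 2 / 2 - 3 * κ) / ε u) := by gcongr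
      _ ≤ E := by
        rw [← Real.exp_add, Real.exp_le_exp, ← add_div]
        gcongr
        linarith
  have t1 : Real.exp (-(η / ε u * (c * η)) - η / ε u * (c * θ)) * mgf (W u) (P u) ((θ + η) / ε u)
      ≤ Real.exp ((c * θ ^ 2 / 2 - 3 * κ) / ε u) := by
    refine (mul_le_mul_of_nonneg_left hm1.2 (Real.exp_pos _).le).trans ?_
    rw [← Real.exp_add, Real.exp_le_exp, le_div_iff₀ he]
    field_simp
    nlinarith
  have t2 : Real.exp (-(η / ε u * (c * η)) + η / ε u * (c * θ)) * mgf (W u) (P u) ((θ - η) / ε u)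
      ≤ Real.exp ((c * θ ^ 2 / 2 - 3 * κ) / ε u) := by
    refine (mul_le_mul_of_nonneg_left hm2.2 (Real.exp_pos _).le).trans ?_
    rw [← Real.exp_add, Real.exp_le_exp, le_div_iff₀ he]
    field_simp
    nlinarith
  have hmain : E ≤ 2 * (Real.exp (θ / ε u * (c * θ) + |θ / ε u| * (c * η))
      * (P u).real {ω | |W u ω - c * θ| < c * η}) := by
    linarith [hm.1]
  have h2 : 2 * Real.exp ((c * θ ^ 2 / 2 - 2 * κ) / ε u) ≤ E := by
    calc 2 * Real.exp ((c * θ ^ 2 / 2 - 2 * κ) / ε u)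
        ≤ Real.exp (κ / ε u) * Real.exp ((c * θ ^ 2 / 2 - 2 * κ) / ε u) := by gcongr; linarith
      _ = E := by rw [← Real.exp_add]; congr 1; ring
  have h3 : Real.exp ((c * θ ^ 2 / 2 - 2 * κ) / ε u)
      ≤ Real.exp (θ / ε u * (c * θ) + |θ / ε u| * (c * η))
        * (P u).real {ω | |W u ω - c * θ| < c * η} := by linarith
  rw [← div_le_iff₀' (Real.exp_pos _), ← Real.exp_sub] at h3
  refine le_trans (Real.exp_le_exp.2 ?_) h3
  rw [mul_div_cancel_left₀ _ hc.ne', abs_div, abs_of_pos he, div_le_iff₀ he]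
  field_simp
  nlinarith

/-- The lower bound of the large deviation principle with Gaussian rate function. -/
theorem le_liminf (h : HasGaussianScaledCGF P W ε c l) {S : Set ℝ} (hS : IsOpen S) {z : ℝ}
    (hz : z ∈ S) :
    ((-(z ^ 2 / (2 * c)) : ℝ) : EReal)
      ≤ liminf (fun u => (ε u : EReal) * ENNReal.log (P u {ω | W u ω ∈ S})) l := by
  rw [← EReal.ge_of_forall_gt_iff_ge]
  intro q hq
  have hq : q < -(z ^ 2 / (2 * c)) := by exact_mod_cast hq
  obtain ⟨r, hr, hrS⟩ := Metric.isOpen_iff.1 hS z hz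
  obtain ⟨γ, hγ, rfl⟩ : ∃ γ : ℝ, 0 < γ ∧ q = -(z ^ 2 / (2 * c)) - 3 * γ :=
    ⟨(-(z ^ 2 / (2 * c)) - q) / 3, by linarith, by ring⟩
  obtain ⟨δ, hδ, hδr, hδγ⟩ : ∃ δ, 0 < δ ∧ δ ≤ r ∧ |z / c| * δ ≤ γ := by
    refine ⟨min r (γ / (|z / c| + 1)), by positivity, min_le_left _ _, ?_⟩
    calc |z / c| * min r (γ / (|z / c| + 1)) ≤ (|z / c| + 1) * (γ / (|z / c| + 1)) := by
          gcongr
          · linarith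
          · exact min_le_right _ _
      _ = γ := by field_simp
  refine le_liminf_of_le (by isBoundedDefault) ?_
  filter_upwards [h.prob, h.speed_pos, h.eventually_exp_le_window z hδ hγ] with u hp he hu
  refine le_mul_log_measure he ?_
  calc Real.exp ((-(z ^ 2 / (2 * c)) - 3 * γ) / ε u)
      ≤ Real.exp ((-(z ^ 2 / (2 * c)) - |z / c| * δ - 2 * γ) / ε u) := by
        refine Real.exp_le_exp.2 (div_le_div_of_nonneg_right ?_ he.le)
        linarith
    _ ≤ (P u).real {ω | |W u ω - z| < δ} := hu
    _ ≤ (P u).real {ω | W u ω ∈ S} := measureReal_mono fun ω hω =>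
        hrS (by simpa [Real.dist_eq] using lt_of_lt_of_le hω hδr)

end HasGaussianScaledCGF

end GaussianLimit

section AbsorptionTime

/-- The discriminant in `Gzero σ β 1` and `Lam σ β 1`. -/
noncomputable def disc (β σ : ℝ) : ℝ := (β + 1 - 2 * σ) ^ 2 - 4 * β

lemma disc_zero (β : ℝ) : disc β 0 = (β - 1) ^ 2 := by
  unfold disc; ring

lemma sqrt_disc_zero {β : ℝ} (hβ : 1 < β) : √(disc β 0) = β - 1 := by
  rw [disc_zero, Real.sqrt_sq (by linarith)]

lemma sqrt_scaled_disc {u : ℝ} (hu : 0 < u) (β σ : ℝ) :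
    √((β * u + u - 2 * (u * σ)) ^ 2 - 4 * (β * u) * u) = u * √(disc β σ) := by
  have h : (β * u + u - 2 * (u * σ)) ^ 2 - 4 * (β * u) * u = u ^ 2 * disc β σ := by
    unfold disc; ring
  rw [h, Real.sqrt_mul (sq_nonneg u), Real.sqrt_sq hu.le]

lemma Gzero_scale {u : ℝ} (hu : 0 < u) (β σ : ℝ) :
    Gzero (u * σ) (β * u) u = (β + 1 - 2 * σ - √(disc β σ)) / 2 := by
  rw [Gzero, sqrt_scaled_disc hu]
  field_simp

lemma Lam_scale {u : ℝ} (hu : 0 < u) (β σ : ℝ) :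
    Lam (u * σ) (β * u) u = u * ((β - 1 - √(disc β σ)) / 2) := by
  rw [Lam, sqrt_scaled_disc hu]
  ring

lemma sStar_scale {u β : ℝ} (hu : 0 < u) (hβ : 1 < β) :
    sStar (β * u) u = u * ((√β - 1) ^ 2 / 2) := by
  have h : √(β * u) = √β * √u := Real.sqrt_mul (by linarith) u
  rw [sStar, h]
  linear_combination ((√β - 1) ^ 2 / 2) * Real.sq_sqrt hu.le

lemma hasDerivAt_sqrt_disc {β : ℝ} (hβ : 1 < β) :
    HasDerivAt (fun σ => √(disc β σ)) (-2 * (β + 1) / (β - 1)) 0 := by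
  have h1 : HasDerivAt (fun σ : ℝ => β + 1 - 2 * σ) (-2) 0 := by
    simpa using ((hasDerivAt_id (0 : ℝ)).const_mul 2).const_sub (β + 1)
  have h2 : HasDerivAt (disc β) (2 * (β + 1) * -2) 0 := by
    exact ((h1.pow 2).sub_const (4 * β)).congr_deriv (by norm_num)
  have hb : β - 1 ≠ 0 := by linarith
  convert h2.sqrt (by rw [disc_zero]; positivity) using 1
  rw [sqrt_disc_zero hβ]
  field_simp

/-- Second order expansion of `Λ(σ;β,1)` at `0`. -/
lemma Lam_expansion {β : ℝ} (hβ : 1 < β) :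
    ∃ q : ℝ → ℝ, Tendsto q (nhds 0) (nhds (4 * β / (β - 1) ^ 3)) ∧
      ∀ᶠ σ in nhds 0, (β - 1 - √(disc β σ)) / 2 - (β + 1) / (β - 1) * σ = σ ^ 2 * q σ := by
  have hb : 0 < β - 1 := by linarith
  set d : ℝ → ℝ := fun σ => (β - 1) * ((β - 1) ^ 2 - 2 * (β + 1) * σ + (β - 1) * √(disc β σ))
  have hd : ContinuousAt d 0 := by
    have := (hasDerivAt_sqrt_disc hβ).continuousAt
    fun_prop
  have hd0 : d 0 = 2 * (β - 1) ^ 3 := by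
    simp only [d, sqrt_disc_zero hβ]; ring
  refine ⟨fun σ => 8 * β / d σ, ?_, ?_⟩
  · have h := (tendsto_const_nhds (x := 8 * β)).div hd.tendsto (by rw [hd0]; positivity)
    rw [hd0] at h
    have e : 8 * β / (2 * (β - 1) ^ 3) = 4 * β / (β - 1) ^ 3 := by field_simp; norm_num
    rwa [e] at h
  · have hdisc : ContinuousAt (disc β) 0 := by unfold disc; fun_prop
    filter_upwards [hd.eventually_ne (by rw [hd0]; positivity : d 0 ≠ 0),
      hdisc.eventually_const_lt (by rw [disc_zero]; positivity : (0 : ℝ) < disc β 0)] with σ h1 h2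
    have h3 : √(disc β σ) ^ 2 = (β + 1 - 2 * σ) ^ 2 - 4 * β := Real.sq_sqrt h2.le
    simp only [d] at h1 ⊢
    rw [mul_div_assoc', eq_div_iff h1]
    field_simp
    linear_combination (-(β - 1) ^ 2) * h3

/-- Reading off the moment generating function from an identity of Lebesgue integrals. -/
lemma integrable_exp_and_mgf_eq {Ω Ω' : Type*} [MeasurableSpace Ω] [MeasurableSpace Ω']
    {μ : Measure Ω} {μ' : Measure Ω'} {X : Ω → ℝ} {Y : Ω' → ℝ} (hX : Measurable X) {s t C : ℝ}
    (hY : Integrable (fun ω => Real.exp (t * Y ω)) μ')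
    (h : ∫⁻ ω, ENNReal.ofReal (Real.exp (s * X ω)) ∂μ
      = (∫⁻ ω, ENNReal.ofReal (Real.exp (t * Y ω)) ∂μ') * ENNReal.ofReal (Real.exp C)) :
    Integrable (fun ω => Real.exp (s * X ω)) μ ∧ mgf X μ s = mgf Y μ' t * Real.exp C := by
  rw [← ofReal_integral_eq_lintegral_ofReal hY (ae_of_all _ fun _ => (Real.exp_pos _).le),
    ← ENNReal.ofReal_mul (integral_nonneg fun _ => (Real.exp_pos _).le)] at h
  have hm : AEStronglyMeasurable (fun ω => Real.exp (s * X ω)) μ := by fun_prop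
  have h0 : 0 ≤ᵐ[μ] fun ω => Real.exp (s * X ω) := ae_of_all _ fun _ => (Real.exp_pos _).le
  refine ⟨(lintegral_ofReal_ne_top_iff_integrable hm h0).1 (by rw [h]; exact ENNReal.ofReal_ne_top),
    ?_⟩
  rw [mgf, integral_eq_lintegral_of_nonneg_ae h0 hm, h, ENNReal.toReal_ofReal]
  · rfl
  · exact mul_nonneg (integral_nonneg fun _ => (Real.exp_pos _).le) (Real.exp_pos _).le

/-- A nonnegative variable with some finite exponential moment has a moment generating function
near `0`. -/
lemma zero_mem_interior_integrableExpSet {Ω : Type*} [MeasurableSpace Ω] {μ : Measure Ω}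
    [IsFiniteMeasure μ] {X : Ω → ℝ} (hX : Measurable X) (hX0 : ∀ ω, 0 ≤ X ω)
    (h : ∃ r : ℝ, 0 < r ∧ ∫⁻ ω, ENNReal.ofReal (Real.exp (r * X ω)) ∂μ < ⊤) :
    0 ∈ interior (integrableExpSet X μ) := by
  obtain ⟨r, hr, hlt⟩ := h
  rw [mem_interior_iff_mem_nhds]
  filter_upwards [Iio_mem_nhds hr] with t ht
  have hI : Integrable (fun ω => Real.exp (r * X ω)) μ :=
    (lintegral_ofReal_ne_top_iff_integrable (by fun_prop)
      (ae_of_all _ fun _ => (Real.exp_pos _).le)).1 hlt.ne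
  refine (hI.add (integrable_const 1)).mono' (by fun_prop) (ae_of_all _ fun ω => ?_)
  rw [Real.norm_of_nonneg (Real.exp_pos _).le]
  have h1 : Real.exp (t * X ω) ≤ Real.exp (r * X ω) :=
    Real.exp_le_exp.2 (mul_le_mul_of_nonneg_right (le_of_lt ht) (hX0 ω))
  simp only [Pi.add_apply]
  linarith

/-- If the laws `ν u` have cumulant generating functions `s ↦ K (s / u) + x u L (s / u)` near `0`,
with a neighbourhood uniform in `u` after rescaling, then the centred variables, rescaled by
`√(u ε u)`, have asymptotically Gaussian scaled cumulant generating functions. -/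
theorem hasGaussianScaledCGF_of_cgf_eq {ν : ℝ → Measure ℝ}
    (hprob : ∀ u > 0, IsProbabilityMeasure (ν u)) {ε : ℝ → ℝ} (hε : ∀ u > 0, 0 < ε u)
    (hε0 : Tendsto ε atTop (nhds 0)) (huε : Tendsto (fun u => u * ε u) atTop atTop)
    {K L q : ℝ → ℝ} {K' L' x a : ℝ} (hx : 0 < x) (ha : 0 < a)
    (hK : HasDerivAt K K' 0) (hL : HasDerivAt L L' 0)
    (hq : Tendsto q (nhds 0) (nhds a)) (hLq : ∀ᶠ σ in nhds 0, L σ - L' * σ = σ ^ 2 * q σ)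
    (hcgf : ∀ᶠ σ in nhds 0, ∀ u > 0, Integrable (fun y => Real.exp (u * σ * y)) (ν u) ∧
      cgf id (ν u) (u * σ) = K σ + x * (u * L σ)) :
    HasGaussianScaledCGF ν (fun u y => √(u * ε u) * (y - ∫ t, t ∂(ν u))) ε (2 * x * a) atTop := by
  have hmean : ∀ u > 0, u * ∫ t, t ∂(ν u) = K' + x * (u * L') := by
    intro u hu
    have := hprob u hu
    have hint : 0 ∈ interior (integrableExpSet id (ν u)) := by
      rw [mem_interior_iff_mem_nhds]
      have ht : Tendsto (fun s : ℝ => s / u) (nhds 0) (nhds 0) := by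
        simpa using (continuous_id.div_const u).tendsto 0
      filter_upwards [ht.eventually hcgf] with s hs
      have := (hs u hu).1
      rwa [mul_div_cancel₀ _ hu.ne'] at this
    have h1 : HasDerivAt (cgf id (ν u)) (∫ t, t ∂(ν u)) (u * 0) := by
      have h := (analyticAt_cgf hint).differentiableAt.hasDerivAt
      rw [deriv_cgf_zero hint] at h
      simpa using h
    have h2 : HasDerivAt (fun σ => cgf id (ν u) (u * σ)) (u * ∫ t, t ∂(ν u)) 0 := by
      have h := h1.comp (0 : ℝ) ((hasDerivAt_id (0 : ℝ)).const_mul u)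
      simpa [mul_comm, Function.comp_def] using h
    have h3 : HasDerivAt (fun σ => K σ + x * (u * L σ)) (K' + x * (u * L')) 0 :=
      hK.add ((hL.const_mul u).const_mul x)
    exact h2.unique (h3.congr_of_eventuallyEq (hcgf.mono fun σ h => (h u hu).2))
  have hτ : Tendsto (fun u => √(u * ε u)) atTop atTop := Real.tendsto_sqrt_atTop.comp huε
  have hσ : ∀ θ : ℝ, Tendsto (fun u => θ / √(u * ε u)) atTop (nhds 0) :=
    fun θ => tendsto_const_nhds.div_atTop hτ
  have hs : ∀ θ : ℝ, ∀ u > 0, θ / ε u * √(u * ε u) = u * (θ / √(u * ε u)) := by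
    intro θ u hu
    have h1 := hε u hu
    have h2 : 0 < √(u * ε u) := Real.sqrt_pos.2 (by positivity)
    field_simp
    rw [Real.sq_sqrt (by positivity)]
    ring
  have hexp : ∀ θ u y : ℝ, u > 0 →
      θ / ε u * (√(u * ε u) * (y - ∫ t, t ∂(ν u)))
        = u * (θ / √(u * ε u)) * y + -(u * (θ / √(u * ε u)) * ∫ t, t ∂(ν u)) := by
    intro θ u y hu
    rw [← mul_assoc, hs θ u hu]
    ring
  refine ⟨by positivity, ?_, fun u => by fun_prop, ?_, hε0, fun θ => ?_, fun θ => ?_⟩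
  · filter_upwards [eventually_gt_atTop 0] with u hu using hprob u hu
  · filter_upwards [eventually_gt_atTop 0] with u hu using hε u hu
  · filter_upwards [eventually_gt_atTop 0, (hσ θ).eventually hcgf] with u hu h
    simp only [hexp θ u _ hu, Real.exp_add]
    exact (h u hu).1.mul_const _
  · have hlim : Tendsto (fun u => ε u * (K (θ / √(u * ε u)) - K' * (θ / √(u * ε u)))
        + x * θ ^ 2 * q (θ / √(u * ε u))) atTop (nhds (2 * x * a * θ ^ 2 / 2)) := by
      have hKc := (hK.continuousAt.tendsto.comp (hσ θ)).sub ((hσ θ).const_mul K')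
      have h := (hε0.mul hKc).add ((hq.comp (hσ θ)).const_mul (x * θ ^ 2))
      have e : 0 * (K 0 - K' * 0) + x * θ ^ 2 * a = 2 * x * a * θ ^ 2 / 2 := by ring
      rwa [e] at h
    refine hlim.congr' ?_
    filter_upwards [eventually_gt_atTop 0, (hσ θ).eventually hcgf, (hσ θ).eventually hLq]
      with u hu h hl
    have := hprob u hu
    have h1 := hε u hu
    have h2 : √(u * ε u) ^ 2 = u * ε u := Real.sq_sqrt (by positivity)
    have h3 : 0 < √(u * ε u) := Real.sqrt_pos.2 (by positivity)
    have hcgf' : cgf (fun y => √(u * ε u) * (y - ∫ t, t ∂(ν u))) (ν u) (θ / ε u)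
        = cgf id (ν u) (u * (θ / √(u * ε u)))
          - u * (θ / √(u * ε u)) * ∫ t, t ∂(ν u) := by
      simp only [cgf, mgf, hexp θ u _ hu, Real.exp_add, integral_mul_const, id]
      rw [Real.log_mul (integral_exp_pos (h u hu).1).ne' (Real.exp_pos _).ne',
        Real.log_exp, sub_eq_add_neg]
    rw [hcgf', (h u hu).2]
    set σ := θ / √(u * ε u) with hσdef
    have h4 : σ ^ 2 * (u * ε u) = θ ^ 2 := by rw [hσdef, div_pow, h2]; field_simp
    linear_combination (ε u * σ) * hmean u hu - (x * u * ε u) * hl - (x * q σ) * h4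

end AbsorptionTime

/-- moderate deviations for `√(με_μ)(A_x(βμ,μ) − E[A_x(βμ,μ)])` as `μ → ∞`,
with speed `1/ε_μ` and rate `z²(β−1)³/(16xβ)`. -/
theorem md_scaling2
    {Θ : Type*} [MeasurableSpace Θ] (Q : Measure Θ) [IsProbabilityMeasure Q]
    (M : Θ → ℕ) (hMmeas : Measurable M) (hM1 : ∀ θ, 1 ≤ M θ)
    (β x : ℝ) (hβ : 1 < β) (hx : 0 < x)
    -- Condition (*)
    (hcond : ∃ r : ℝ, 0 < r ∧ ∫⁻ θ, ENNReal.ofReal (Real.exp (r * (M θ : ℝ))) ∂Q < ⊤)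
    -- the laws ν_μ of the absorption times A_x(βμ,μ)
    (ν : ℝ → Measure ℝ) (hprob : ∀ u > 0, IsProbabilityMeasure (ν u))
    (hsupp : ∀ u > 0, ν u (Set.Iio 0) = 0)
    (hmgf_le : ∀ u > 0, ∀ s ≤ sStar (β * u) u,
      ∫⁻ y, ENNReal.ofReal (Real.exp (s * y)) ∂(ν u)
        = (∫⁻ θ, ENNReal.ofReal (Real.exp (Real.log (Gzero s (β * u) u) * (M θ : ℝ))) ∂Q)
            * ENNReal.ofReal (Real.exp (x * Lam s (β * u) u)))
    (hmgf_gt : ∀ u > 0, ∀ s > sStar (β * u) u,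
      ∫⁻ y, ENNReal.ofReal (Real.exp (s * y)) ∂(ν u) = ⊤)
    -- the scaling ε_μ
    (ε : ℝ → ℝ) (hε : ∀ u > 0, 0 < ε u)
    (hε0 : Tendsto ε atTop (nhds 0)) (huε : Tendsto (fun u => u * ε u) atTop atTop) :
    -- (a) upper bound for closed sets
    (∀ F : Set ℝ, IsClosed F →
      limsup (fun u : ℝ => ((ε u : ℝ) : EReal) *
          ENNReal.log (ν u {y | Real.sqrt (u * ε u) * (y - ∫ t, t ∂(ν u)) ∈ F})) atTop
        ≤ -((⨅ z ∈ F, ENNReal.ofReal (z ^ 2 * (β - 1) ^ 3 / (16 * x * β)) : ℝ≥0∞) : EReal))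
    -- (b) lower bound for open sets
    ∧ (∀ G : Set ℝ, IsOpen G →
      -((⨅ z ∈ G, ENNReal.ofReal (z ^ 2 * (β - 1) ^ 3 / (16 * x * β)) : ℝ≥0∞) : EReal)
        ≤ liminf (fun u : ℝ => ((ε u : ℝ) : EReal) *
            ENNReal.log (ν u {y | Real.sqrt (u * ε u) * (y - ∫ t, t ∂(ν u)) ∈ G})) atTop) := by
  have hb : 0 < β - 1 := by linarith
  have hM : Measurable fun θ => (M θ : ℝ) := measurable_from_nat.comp hMmeas
  have hint := zero_mem_interior_integrableExpSet hM (fun θ => Nat.cast_nonneg _) hcond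
  obtain ⟨q, hq, hLq⟩ := Lam_expansion hβ
  have hsd := hasDerivAt_sqrt_disc hβ
  have hL : HasDerivAt (fun σ => (β - 1 - √(disc β σ)) / 2) ((β + 1) / (β - 1)) 0 := by
    refine ((hsd.const_sub (β - 1)).div_const 2).congr_deriv ?_
    ring
  set T : ℝ → ℝ := fun σ => Real.log ((β + 1 - 2 * σ - √(disc β σ)) / 2)
  have hT0 : T 0 = 0 := by
    have h : (β + 1 - 2 * 0 - √(disc β 0)) / 2 = 1 := by rw [sqrt_disc_zero hβ]; ring
    simp only [T, h, Real.log_one]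
  have hT : DifferentiableAt ℝ T 0 := by
    have h := hsd.differentiableAt
    have h1 : (β + 1 - 2 * 0 - √(disc β 0)) / 2 ≠ 0 := by
      rw [sqrt_disc_zero hβ]; norm_num
    exact DifferentiableAt.log (by fun_prop) h1
  set K : ℝ → ℝ := fun σ => cgf (fun θ => (M θ : ℝ)) Q (T σ)
  have hK : DifferentiableAt ℝ K 0 :=
    DifferentiableAt.comp (g := cgf (fun θ => (M θ : ℝ)) Q) 0
      (by rw [hT0]; exact (analyticAt_cgf hint).differentiableAt) hT
  have hTmem : ∀ᶠ σ in nhds 0, T σ ∈ integrableExpSet (fun θ => (M θ : ℝ)) Q :=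
    hT.continuousAt.eventually_mem (by rw [hT0]; exact mem_interior_iff_mem_nhds.1 hint)
  have hpos : 0 < (√β - 1) ^ 2 / 2 := by
    have : 1 < √β := Real.lt_sqrt_of_sq_lt (by simpa using hβ)
    have : 0 < √β - 1 := by linarith
    positivity
  have hcgf : ∀ᶠ σ in nhds 0, ∀ u > 0, Integrable (fun y => Real.exp (u * σ * y)) (ν u) ∧
      cgf id (ν u) (u * σ) = K σ + x * (u * ((β - 1 - √(disc β σ)) / 2)) := by
    filter_upwards [hTmem, Iio_mem_nhds hpos] with σ h1 h2 u hu
    have h3 := hmgf_le u hu (u * σ) (by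
      rw [sStar_scale hu hβ]; exact mul_le_mul_of_nonneg_left (le_of_lt h2) hu.le)
    rw [Gzero_scale hu, Lam_scale hu] at h3
    obtain ⟨h4, h5⟩ := integrable_exp_and_mgf_eq (X := id) measurable_id h1 h3
    refine ⟨h4, ?_⟩
    rw [cgf, h5, Real.log_mul (mgf_pos h1).ne' (Real.exp_pos _).ne', Real.log_exp]
    rfl
  have key := hasGaussianScaledCGF_of_cgf_eq hprob hε hε0 huε hx (by positivity)
    hK.hasDerivAt hL hq hLq hcgf
  have hrate : ∀ z : ℝ, z ^ 2 * (β - 1) ^ 3 / (16 * x * β)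
      = z ^ 2 / (2 * (2 * x * (4 * β / (β - 1) ^ 3))) := by
    intro z
    have : 0 < β := by linarith
    field_simp
    ring
  have hrate0 : ∀ z : ℝ, 0 ≤ z ^ 2 / (2 * (2 * x * (4 * β / (β - 1) ^ 3))) := by
    intro z
    have := key.pos
    positivity
  simp only [hrate]
  refine ⟨fun F _ => ?_, fun G hG => ?_⟩
  · rw [← EReal.le_of_forall_lt_iff_le]
    intro r hr
    rw [EReal.neg_lt_comm] at hr
    have h1 : ENNReal.ofReal (-r) ≤ ⨅ z ∈ F,
        ENNReal.ofReal (z ^ 2 / (2 * (2 * x * (4 * β / (β - 1) ^ 3)))) := by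
      rw [← EReal.coe_ennreal_le_coe_ennreal_iff, EReal.coe_ennreal_ofReal]
      rcases max_choice (-r) 0 with h | h
      · rw [h]; exact_mod_cast hr.le
      · rw [h]; exact EReal.coe_ennreal_nonneg _
    have h2 := key.limsup_le (S := F) (R := max (-r) 0) (le_max_right _ _) fun z hz =>
      max_le ((ENNReal.ofReal_le_ofReal_iff (hrate0 z)).1 (h1.trans (iInf₂_le z hz))) (hrate0 z)
    refine h2.trans ?_
    rw [EReal.coe_le_coe_iff]
    linarith [le_max_left (-r) 0]
  · rw [← EReal.ge_of_forall_gt_iff_ge]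
    intro r hr
    rw [EReal.lt_neg_comm] at hr
    have h1 : (⨅ z ∈ G, ENNReal.ofReal (z ^ 2 / (2 * (2 * x * (4 * β / (β - 1) ^ 3)))))
        < ENNReal.ofReal (-r) := by
      rw [← EReal.coe_ennreal_lt_coe_ennreal_iff, EReal.coe_ennreal_ofReal]
      exact hr.trans_le (by exact_mod_cast le_max_left (-r) 0)
    simp only [iInf_lt_iff] at h1
    obtain ⟨z, hz, hlt⟩ := h1
    have h2 := (ENNReal.ofReal_lt_ofReal_iff_of_nonneg (hrate0 z)).1 hlt
    refine le_trans ?_ (key.le_liminf hG hz)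
    rw [EReal.coe_le_coe_iff]
    linarith
end

section
/- Let β > 1, x > 0, and let M satisfy Condition (*) with s_M ≥ log√β. Let (ε_μ)_{μ>0} be positive numbers with ε_μ → 0 and μ·ε_μ → ∞ as μ → ∞. For each μ > 0 let ν_μ be a Borel probability measure on [0,∞) with ∫ e^{sy} ν_μ(dy) = G_M(log G₀(s;βμ,μ))·e^{(x/(με_μ))Λ(s;βμ,μ)} (an equality in (0,∞]) for every s ≤ s*(βμ,μ), and ∫ e^{sy} ν_μ(dy) = ∞ for every s > s*(βμ,μ). Define I₂(z) := (x/2)·(√((z/x − 1)β) − √(z/x + 1))² for z ≥ x and I₂(z) := +∞ for z < x. Then: (a) for every closed set F ⊆ ℝ, limsup_{μ→∞} ε_μ·log ν_μ({y : μ·ε_μ·y ∈ F}) ≤ −inf_{z∈F} I₂(z); (b) for every open set G ⊆ ℝ, liminf_{μ→∞} ε_μ·log ν_μ({y : μ·ε_μ·y ∈ G}) ≥ −inf_{z∈G} I₂(z). -/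
open MeasureTheory ProbabilityTheory Filter
open scoped ENNReal

/-- The exponential moment of `ρ u` at `θ / ε u` is `c * exp (l / ε u)` for large `u`, with `c > 0`
independent of `u`. -/
def HasExpAsymp (ρ : ℝ → Measure ℝ) (ε : ℝ → ℝ) (θ l : ℝ) : Prop :=
  ∃ c : ℝ, 0 < c ∧ ∀ᶠ u in atTop,
    ∫⁻ y, ENNReal.ofReal (Real.exp (θ * y / ε u)) ∂(ρ u) = ENNReal.ofReal (c * Real.exp (l / ε u))

section
variable {ρ : ℝ → Measure ℝ} {ε : ℝ → ℝ}

lemma eventually_mul_exp_le (hε : Tendsto ε atTop (nhdsWithin 0 (Set.Ioi 0))) (c : ℝ) {a b : ℝ}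
    (hab : a < b) : ∀ᶠ u in atTop, c * Real.exp (a / ε u) ≤ Real.exp (b / ε u) := by
  have h1 : Tendsto (fun u => Real.exp ((b - a) * (ε u)⁻¹)) atTop atTop :=
    Real.tendsto_exp_atTop.comp
      ((tendsto_inv_nhdsGT_zero.comp hε).const_mul_atTop (sub_pos.2 hab))
  filter_upwards [h1.eventually_ge_atTop c] with u hu
  calc c * Real.exp (a / ε u) ≤ Real.exp ((b - a) * (ε u)⁻¹) * Real.exp (a / ε u) := by gcongr
    _ = Real.exp (b / ε u) := by rw [← Real.exp_add]; congr 1; ring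

lemma HasExpAsymp.setLIntegral_le (hε : Tendsto ε atTop (nhdsWithin 0 (Set.Ioi 0)))
    {θ' l' : ℝ} (h : HasExpAsymp ρ ε θ' l') {θ z B : ℝ} {S : Set ℝ} (hS : MeasurableSet S)
    (hz : ∀ y ∈ S, (θ' - θ) * z ≤ (θ' - θ) * y) (hB : l' - (θ' - θ) * z < B) :
    ∀ᶠ u in atTop, ∫⁻ y in S, ENNReal.ofReal (Real.exp (θ * y / ε u)) ∂(ρ u)
      ≤ ENNReal.ofReal (Real.exp (B / ε u)) := by
  obtain ⟨c, hc, h⟩ := h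
  filter_upwards [h, eventually_mul_exp_le hε c hB, hε.eventually self_mem_nhdsWithin]
    with u hu hle hpos
  have hpos : 0 < ε u := hpos
  calc ∫⁻ y in S, ENNReal.ofReal (Real.exp (θ * y / ε u)) ∂(ρ u)
      ≤ ∫⁻ y in S, ENNReal.ofReal (Real.exp (-((θ' - θ) * z) / ε u)) *
          ENNReal.ofReal (Real.exp (θ' * y / ε u)) ∂(ρ u) := by
        refine setLIntegral_mono' hS fun y hy => ?_
        rw [← ENNReal.ofReal_mul (Real.exp_pos _).le, ← Real.exp_add, ← add_div]
        gcongr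
        linarith [hz y hy]
    _ ≤ ∫⁻ y, ENNReal.ofReal (Real.exp (-((θ' - θ) * z) / ε u)) *
          ENNReal.ofReal (Real.exp (θ' * y / ε u)) ∂(ρ u) := setLIntegral_le_lintegral _ _
    _ = ENNReal.ofReal (c * Real.exp ((l' - (θ' - θ) * z) / ε u)) := by
        rw [lintegral_const_mul _ (by fun_prop), hu, ← ENNReal.ofReal_mul (Real.exp_pos _).le,
          mul_left_comm, ← Real.exp_add]
        congr 3; ring
    _ ≤ _ := ENNReal.ofReal_le_ofReal hle

lemma HasExpAsymp.measure_le (hε : Tendsto ε atTop (nhdsWithin 0 (Set.Ioi 0)))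
    {θ l : ℝ} (h : HasExpAsymp ρ ε θ l) {z A : ℝ} {S : Set ℝ} (hS : MeasurableSet S)
    (hz : ∀ y ∈ S, θ * z ≤ θ * y) (hA : A < θ * z - l) :
    ∀ᶠ u in atTop, ρ u S ≤ ENNReal.ofReal (Real.exp (-A / ε u)) := by
  filter_upwards [h.setLIntegral_le hε (θ := 0) (z := z) (B := -A) hS (by simpa using hz)
    (by linarith)] with u hu
  simpa using hu

lemma HasExpAsymp.le_measure_Ioo (hρ : ∀ᶠ u in atTop, IsFiniteMeasure (ρ u))
    (hε : Tendsto ε atTop (nhdsWithin 0 (Set.Ioi 0)))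
    {θ θ₁ θ₂ l l₁ l₂ z δ B : ℝ} (h : HasExpAsymp ρ ε θ l) (h₁ : HasExpAsymp ρ ε θ₁ l₁)
    (h₂ : HasExpAsymp ρ ε θ₂ l₂) (hθ₁ : θ₁ < θ) (hθ₂ : θ < θ₂)
    (hl₁ : l₁ - l < (θ₁ - θ) * (z - δ)) (hl₂ : l₂ - l < (θ₂ - θ) * (z + δ))
    (hB : B < l - (θ * z + |θ| * δ)) :
    ∀ᶠ u in atTop, ENNReal.ofReal (Real.exp (B / ε u)) ≤ ρ u (Set.Ioo (z - δ) (z + δ)) := by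
  obtain ⟨c, hc, h⟩ := h
  obtain ⟨B₁, hB₁, hB₁'⟩ := exists_between (show l₁ - (θ₁ - θ) * (z - δ) < l by linarith)
  obtain ⟨B₂, hB₂, hB₂'⟩ := exists_between (show l₂ - (θ₂ - θ) * (z + δ) < l by linarith)
  filter_upwards [hρ, h,
    h₁.setLIntegral_le hε (S := Set.Iic (z - δ)) measurableSet_Iic
      (fun y hy => mul_le_mul_of_nonpos_left hy (by linarith)) hB₁,
    h₂.setLIntegral_le hε (S := Set.Ici (z + δ)) measurableSet_Ici
      (fun y hy => mul_le_mul_of_nonneg_left hy (by linarith)) hB₂,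
    eventually_mul_exp_le hε (4 / c) hB₁', eventually_mul_exp_le hε (4 / c) hB₂',
    eventually_mul_exp_le hε (2 / c) hB, hε.eventually self_mem_nhdsWithin]
    with u _ hu hu₁ hu₂ hc₁ hc₂ hcB hpos
  have hpos : 0 < ε u := hpos
  rw [div_mul_eq_mul_div, div_le_iff₀ hc] at hc₁ hc₂ hcB
  set E := Real.exp (l / ε u)
  set K := Real.exp ((θ * z + |θ| * δ) / ε u)
  have hcover : (Set.univ : Set ℝ) ⊆
      Set.Ioo (z - δ) (z + δ) ∪ (Set.Iic (z - δ) ∪ Set.Ici (z + δ)) := by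
    intro y _
    simp only [Set.mem_union, Set.mem_Ioo, Set.mem_Iic, Set.mem_Ici]
    grind
  have hI : ∫⁻ y in Set.Ioo (z - δ) (z + δ), ENNReal.ofReal (Real.exp (θ * y / ε u)) ∂(ρ u)
      ≤ ENNReal.ofReal K * ρ u (Set.Ioo (z - δ) (z + δ)) := by
    rw [← setLIntegral_const]
    refine setLIntegral_mono' measurableSet_Ioo fun y hy => ?_
    have : |y - z| ≤ δ := abs_le.2 ⟨by linarith [hy.1], by linarith [hy.2]⟩
    have h2 : θ * (y - z) ≤ |θ| * δ :=
      (le_abs_self _).trans (by rw [abs_mul]; gcongr)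
    refine ENNReal.ofReal_le_ofReal (Real.exp_le_exp.2 (div_le_div_of_nonneg_right ?_ hpos.le))
    linarith
  have hsum : ENNReal.ofReal (c * E) ≤ ENNReal.ofReal K * ρ u (Set.Ioo (z - δ) (z + δ)) +
      (ENNReal.ofReal (Real.exp (B₁ / ε u)) + ENNReal.ofReal (Real.exp (B₂ / ε u))) := by
    rw [← hu, ← setLIntegral_univ]
    refine (lintegral_mono_set hcover).trans ((lintegral_union_le _ _ _).trans ?_)
    exact add_le_add hI ((lintegral_union_le _ _ _).trans (add_le_add hu₁ hu₂))
  have hfin : ρ u (Set.Ioo (z - δ) (z + δ)) ≠ ⊤ := measure_ne_top _ _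
  rw [← ENNReal.ofReal_toReal hfin] at hsum ⊢
  set m := (ρ u (Set.Ioo (z - δ) (z + δ))).toReal
  have hm : 0 ≤ m := ENNReal.toReal_nonneg
  rw [← ENNReal.ofReal_mul (by positivity), ← ENNReal.ofReal_add (by positivity) (by positivity),
    ← ENNReal.ofReal_add (by positivity) (by positivity),
    ENNReal.ofReal_le_ofReal_iff (by positivity)] at hsum
  refine ENNReal.ofReal_le_ofReal ?_
  have hEK : Real.exp ((l - (θ * z + |θ| * δ)) / ε u) * K = E := by
    rw [← Real.exp_add]; congr 1; ring
  have hK : 0 < K := Real.exp_pos _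
  refine le_of_mul_le_mul_right ?_ hK
  nlinarith [mul_le_mul_of_nonneg_right hcB hK.le]

lemma eps_mul_log_ofReal_exp {e : ℝ} (he : 0 < e) (B : ℝ) :
    (e : EReal) * ENNReal.log (ENNReal.ofReal (Real.exp (B / e))) = B := by
  rw [ENNReal.log_ofReal_of_pos (Real.exp_pos _), Real.log_exp, ← EReal.coe_mul]
  congr 1; field_simp

lemma limsup_eps_mul_log_le (hε : Tendsto ε atTop (nhdsWithin 0 (Set.Ioi 0))) {p : ℝ → ℝ≥0∞}
    {B : ℝ} (h : ∀ᶠ u in atTop, p u ≤ ENNReal.ofReal (Real.exp (B / ε u))) :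
    limsup (fun u => (ε u : EReal) * ENNReal.log (p u)) atTop ≤ B := by
  refine limsup_le_of_le (by isBoundedDefault) ?_
  filter_upwards [h, hε.eventually self_mem_nhdsWithin] with u hu hpos
  rw [← eps_mul_log_ofReal_exp hpos B]
  exact mul_le_mul_of_nonneg_left (ENNReal.log_monotone hu) (by exact_mod_cast (le_of_lt hpos))

lemma le_liminf_eps_mul_log (hε : Tendsto ε atTop (nhdsWithin 0 (Set.Ioi 0))) {p : ℝ → ℝ≥0∞}
    {B : ℝ} (h : ∀ᶠ u in atTop, ENNReal.ofReal (Real.exp (B / ε u)) ≤ p u) :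
    B ≤ liminf (fun u => (ε u : EReal) * ENNReal.log (p u)) atTop := by
  refine le_liminf_of_le (by isBoundedDefault) ?_
  filter_upwards [h, hε.eventually self_mem_nhdsWithin] with u hu hpos
  rw [← eps_mul_log_ofReal_exp hpos B]
  exact mul_le_mul_of_nonneg_left (ENNReal.log_monotone hu) (by exact_mod_cast (le_of_lt hpos))
end

/-- The tilting parameter `θ` with `G₀(θ;β,1) = g`. -/
noncomputable def tilt (β g : ℝ) : ℝ := (β + 1 - g - β / g) / 2

/-- The value `Λ(θ;β,1)` at `θ = tilt β g`. -/
noncomputable def tiltCgf (β g : ℝ) : ℝ := (β - 1 - β / g + g) / 2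

section
variable {β g : ℝ}

lemma tilt_eq (hg : 0 < g) : tilt β g = (g - 1) * (β - g) / (2 * g) := by
  unfold tilt; field_simp; ring

lemma sq_lt_of_lt_sqrt (hg : 0 < g) (hgβ : g < Real.sqrt β) : g ^ 2 < β :=
  (Real.lt_sqrt hg.le).1 hgβ

lemma tilt_discr {u : ℝ} (hu : 0 < u) (hg : 0 < g) (hgβ : g < Real.sqrt β) :
    Real.sqrt ((β * u + u - 2 * (u * tilt β g)) ^ 2 - 4 * (β * u) * u) = u * (β / g - g) := by
  have h : (β * u + u - 2 * (u * tilt β g)) ^ 2 - 4 * (β * u) * u = (u * (β / g - g)) ^ 2 := by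
    unfold tilt; field_simp; ring
  have h2 : g ≤ β / g := by
    rw [le_div_iff₀ hg]; nlinarith [sq_lt_of_lt_sqrt hg hgβ]
  rw [h, Real.sqrt_sq (mul_nonneg hu.le (by linarith))]

lemma Gzero_tilt {u : ℝ} (hu : 0 < u) (hg : 0 < g) (hgβ : g < Real.sqrt β) :
    Gzero (u * tilt β g) (β * u) u = g := by
  rw [Gzero, tilt_discr hu hg hgβ, tilt]
  field_simp
  ring

lemma Lam_tilt {u : ℝ} (hu : 0 < u) (hg : 0 < g) (hgβ : g < Real.sqrt β) :
    Lam (u * tilt β g) (β * u) u = u * tiltCgf β g := by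
  rw [Lam, tilt_discr hu hg hgβ, tiltCgf]
  ring

lemma mul_tilt_le_sStar {u : ℝ} (hu : 0 < u) (hβ : 0 < β) (hg : 0 < g) :
    u * tilt β g ≤ sStar (β * u) u := by
  have h1 : sStar (β * u) u = u * ((Real.sqrt β - 1) ^ 2 / 2) := by
    rw [sStar, Real.sqrt_mul hβ.le]
    linear_combination (Real.sqrt β - 1) ^ 2 / 2 * Real.sq_sqrt hu.le
  have h2 : (Real.sqrt β - 1) ^ 2 / 2 - tilt β g = (g - Real.sqrt β) ^ 2 / (2 * g) := by
    have h3 : g * (β / g) = β := by field_simp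
    rw [tilt, eq_div_iff (by positivity)]
    linear_combination h3 + (g - 1) * Real.sq_sqrt hβ.le
  rw [h1]
  have : 0 ≤ (g - Real.sqrt β) ^ 2 / (2 * g) := by positivity
  gcongr
  linarith

lemma exists_tilt_eq_rate {x z : ℝ} (hβ : 1 < β) (hx : 0 < x) (hz : x < z) :
    ∃ g, 0 < g ∧ g < Real.sqrt β ∧ z * (β - g ^ 2) = x * (β + g ^ 2) ∧
      tilt β g * z - x * tiltCgf β g =
        x / 2 * (Real.sqrt ((z / x - 1) * β) - Real.sqrt (z / x + 1)) ^ 2 := by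
  have hw : 1 < z / x := (one_lt_div hx).2 hz
  have hw1 : 0 < (z / x - 1) * β := mul_pos (by linarith) (by linarith)
  have hw2 : 0 < z / x + 1 := by linarith
  obtain ⟨p, hp⟩ : ∃ p, p = Real.sqrt ((z / x - 1) * β) := ⟨_, rfl⟩
  obtain ⟨q, hq⟩ : ∃ q, q = Real.sqrt (z / x + 1) := ⟨_, rfl⟩
  have hp0 : 0 < p := hp ▸ Real.sqrt_pos.2 hw1
  have hq0 : 0 < q := hq ▸ Real.sqrt_pos.2 hw2
  have hp2 : x * p ^ 2 = (z - x) * β := by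
    rw [hp, Real.sq_sqrt hw1.le]; field_simp
  have hq2 : x * q ^ 2 = z + x := by
    rw [hq, Real.sq_sqrt hw2.le]; field_simp
  have hpg : p = p / q * q := by field_simp
  rw [← hp, ← hq]
  obtain ⟨g, hg⟩ : ∃ g, g = p / q := ⟨_, rfl⟩
  rw [← hg] at hpg
  have hg0 : 0 < g := hg ▸ div_pos hp0 hq0
  have hzg : z * (β - g ^ 2) = x * (β + g ^ 2) := by
    subst hpg
    linear_combination (-1 : ℝ) * hp2 + g ^ 2 * hq2
  refine ⟨g, hg0, ?_, hzg, ?_⟩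
  · rw [Real.lt_sqrt hg0.le]
    have : 0 < x * (β + g ^ 2) := by positivity
    rw [← hzg] at this
    linarith [pos_of_mul_pos_right this (by linarith : (0 : ℝ) ≤ z)]
  · have h3 : g * (β / g) = β := by field_simp
    have h4 : g * (tilt β g * z - x * tiltCgf β g) = g * (x / 2 * (p - q) ^ 2) := by
      rw [tilt, tiltCgf, hpg]
      linear_combination (-z + x) / 2 * h3 + (g - 1) / 2 * hzg - g * (g - 1) ^ 2 / 2 * hq2
    exact mul_left_cancel₀ hg0.ne' h4

lemma exists_tilt_nonneg {x z A : ℝ} (hβ : 1 < β) (hx : 0 < x)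
    (hz : x * (β + 1) / (β - 1) ≤ z)
    (hA : A < x / 2 * (Real.sqrt ((z / x - 1) * β) - Real.sqrt (z / x + 1)) ^ 2) :
    ∃ g, 0 < g ∧ g < Real.sqrt β ∧ 0 ≤ tilt β g ∧ A < tilt β g * z - x * tiltCgf β g := by
  rw [div_le_iff₀ (by linarith)] at hz
  have hxz : x < z := by nlinarith
  obtain ⟨g, hg, hgβ, hzg, hr⟩ := exists_tilt_eq_rate hβ hx hxz
  refine ⟨g, hg, hgβ, ?_, hr ▸ hA⟩
  have h2 := sq_lt_of_lt_sqrt hg hgβ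
  have h1 : 1 ≤ g := by
    by_contra! h
    have : g ^ 2 < 1 := by nlinarith
    nlinarith
  rw [tilt_eq hg]
  have : g ≤ β := by nlinarith
  exact div_nonneg (mul_nonneg (by linarith) (by linarith)) (by linarith)

lemma exists_tilt_nonpos {x z A : ℝ} (hβ : 1 < β) (hx : 0 < x)
    (hz : z ≤ x * (β + 1) / (β - 1))
    (hA : x ≤ z →
      A < x / 2 * (Real.sqrt ((z / x - 1) * β) - Real.sqrt (z / x + 1)) ^ 2) :
    ∃ g, 0 < g ∧ g < Real.sqrt β ∧ tilt β g ≤ 0 ∧ A < tilt β g * z - x * tiltCgf β g := by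
  have hsβ : 1 < Real.sqrt β := by rw [Real.lt_sqrt] <;> linarith
  have hkey : ∀ g, tilt β g * z - x * tiltCgf β g = tilt β g * (z - x) + x * (1 - g) := by
    intro g; unfold tilt tiltCgf; ring
  have hnonpos : ∀ {g}, 0 < g → g ≤ 1 → tilt β g ≤ 0 := fun {g} hg hg1 => by
    rw [tilt_eq hg]
    exact div_nonpos_of_nonpos_of_nonneg
      (mul_nonpos_of_nonpos_of_nonneg (by linarith) (by linarith)) (by linarith)
  rcases lt_trichotomy z x with hzx | rfl | hxz
  · have h1 : Tendsto (fun g : ℝ => g⁻¹ * ((β - g) * (1 - g) / 2 * (x - z))) (nhdsWithin 0 (Set.Ioi 0))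
        atTop := by
      refine tendsto_inv_nhdsGT_zero.atTop_mul_pos (C := (β - 0) * (1 - 0) / 2 * (x - z))
        (by nlinarith) ?_
      exact ((by fun_prop : Continuous fun g : ℝ => (β - g) * (1 - g) / 2 * (x - z)).tendsto
        0).mono_left nhdsWithin_le_nhds
    obtain ⟨g, hAg, hg0, hg1⟩ := ((h1.eventually_gt_atTop A).and
      (Ioo_mem_nhdsGT (zero_lt_one' ℝ))).exists
    refine ⟨g, hg0, hg1.trans hsβ, hnonpos hg0 hg1.le, ?_⟩
    rw [hkey, tilt_eq hg0]
    have : (g - 1) * (β - g) / (2 * g) * (z - x) = g⁻¹ * ((β - g) * (1 - g) / 2 * (x - z)) := by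
      field_simp; ring
    rw [this]
    nlinarith
  · have hA := hA le_rfl
    rw [div_self hx.ne', sub_self, zero_mul, Real.sqrt_zero, zero_sub, neg_sq,
      Real.sq_sqrt (by norm_num)] at hA
    have h1 : Tendsto (fun g : ℝ => z * (1 - g)) (nhdsWithin 0 (Set.Ioi 0)) (nhds (z * (1 - 0))) :=
      ((by fun_prop : Continuous fun g : ℝ => z * (1 - g)).tendsto 0).mono_left nhdsWithin_le_nhds
    obtain ⟨g, hAg, hg0, hg1⟩ := ((h1.eventually_const_lt (by linarith : A < z * (1 - 0))).and
      (Ioo_mem_nhdsGT (zero_lt_one' ℝ))).exists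
    exact ⟨g, hg0, hg1.trans hsβ, hnonpos hg0 hg1.le, by rw [hkey]; linarith⟩
  · obtain ⟨g, hg, hgβ, hzg, hr⟩ := exists_tilt_eq_rate hβ hx hxz
    rw [le_div_iff₀ (by linarith)] at hz
    refine ⟨g, hg, hgβ, hnonpos hg ?_, hr ▸ hA hxz.le⟩
    have h2 := sq_lt_of_lt_sqrt hg hgβ
    by_contra! h
    have : 1 < g ^ 2 := by nlinarith
    nlinarith

lemma tilt_sub {g' : ℝ} (hg : 0 < g) (hg' : 0 < g') :
    tilt β g' - tilt β g = (g' - g) / (2 * g * g') * (β - g * g') := by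
  unfold tilt; field_simp; ring

lemma tiltCgf_sub {g' : ℝ} (hg : 0 < g) (hg' : 0 < g') :
    tiltCgf β g' - tiltCgf β g = (g' - g) / (2 * g * g') * (β + g * g') := by
  unfold tiltCgf; field_simp; ring

lemma exists_tilt_gt {x z δ : ℝ} (hg : 0 < g) (hgβ : g < Real.sqrt β)
    (hz : z * (β - g ^ 2) = x * (β + g ^ 2)) (hδ : 0 < δ) :
    ∃ g', 0 < g' ∧ g' < Real.sqrt β ∧ tilt β g < tilt β g' ∧
      x * tiltCgf β g' - x * tiltCgf β g < (tilt β g' - tilt β g) * (z + δ) := by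
  have h2 := sq_lt_of_lt_sqrt hg hgβ
  have hlt : x * (β + g * g) < (β - g * g) * (z + δ) := by nlinarith
  have hev : ∀ᶠ g' in nhdsWithin g (Set.Ioi g),
      0 < β - g * g' ∧ x * (β + g * g') < (β - g * g') * (z + δ) := by
    refine Filter.Eventually.filter_mono nhdsWithin_le_nhds (Filter.Eventually.and ?_ ?_)
    · exact ((by fun_prop : Continuous fun g' => β - g * g').tendsto g).eventually_const_lt
        (by nlinarith)
    · exact Filter.Tendsto.eventually_lt ((by fun_prop :
        Continuous fun g' => x * (β + g * g')).tendsto g) ((by fun_prop :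
        Continuous fun g' => (β - g * g') * (z + δ)).tendsto g) hlt
  obtain ⟨g', ⟨h1, h3⟩, hgg', hg'β⟩ := (hev.and (Ioo_mem_nhdsGT hgβ)).exists
  have hg' : 0 < g' := hg.trans hgg'
  have hc : 0 < (g' - g) / (2 * g * g') := div_pos (by linarith) (by positivity)
  refine ⟨g', hg', hg'β, ?_, ?_⟩
  · rw [← sub_pos, tilt_sub hg hg']; positivity
  · rw [← mul_sub, tilt_sub hg hg', tiltCgf_sub hg hg']
    linarith [mul_lt_mul_of_pos_left h3 hc]

lemma exists_tilt_lt {x z δ : ℝ} (hg : 0 < g) (hgβ : g < Real.sqrt β)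
    (hz : z * (β - g ^ 2) = x * (β + g ^ 2)) (hδ : 0 < δ) :
    ∃ g', 0 < g' ∧ g' < Real.sqrt β ∧ tilt β g' < tilt β g ∧
      x * tiltCgf β g' - x * tiltCgf β g < (tilt β g' - tilt β g) * (z - δ) := by
  have h2 := sq_lt_of_lt_sqrt hg hgβ
  have hlt : (β - g * g) * (z - δ) < x * (β + g * g) := by nlinarith
  have hev : ∀ᶠ g' in nhdsWithin g (Set.Iio g),
      0 < β - g * g' ∧ (β - g * g') * (z - δ) < x * (β + g * g') := by
    refine Filter.Eventually.filter_mono nhdsWithin_le_nhds (Filter.Eventually.and ?_ ?_)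
    · exact ((by fun_prop : Continuous fun g' => β - g * g').tendsto g).eventually_const_lt
        (by nlinarith)
    · exact Filter.Tendsto.eventually_lt ((by fun_prop :
        Continuous fun g' => (β - g * g') * (z - δ)).tendsto g) ((by fun_prop :
        Continuous fun g' => x * (β + g * g')).tendsto g) hlt
  obtain ⟨g', ⟨h1, h3⟩, hg', hgg'⟩ := (hev.and (Ioo_mem_nhdsLT hg)).exists
  have hc : 0 < (g - g') / (2 * g * g') := div_pos (by linarith) (by positivity)
  have hc' : (g' - g) / (2 * g * g') = -((g - g') / (2 * g * g')) := by ring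
  refine ⟨g', hg', hgg'.trans hgβ, ?_, ?_⟩
  · rw [← sub_neg, tilt_sub hg hg', hc']
    linarith [mul_pos hc h1]
  · rw [← mul_sub, tilt_sub hg hg', tiltCgf_sub hg hg', hc']
    linarith [mul_lt_mul_of_pos_left h3 hc]
end

lemma hasExpAsymp_map_of_mgf {Θ : Type*} [MeasurableSpace Θ] {Q : Measure Θ}
    [IsProbabilityMeasure Q] {M : Θ → ℕ} (hMmeas : Measurable M) {β x g : ℝ} (hβ : 0 < β)
    (hsM : ∀ r : ℝ, r < Real.log (Real.sqrt β) →
      ∫⁻ θ, ENNReal.ofReal (Real.exp (r * (M θ : ℝ))) ∂Q < ⊤)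
    {ε : ℝ → ℝ} (hε : ∀ u > 0, 0 < ε u) {ν : ℝ → Measure ℝ}
    (hmgf : ∀ u > 0, ∀ s ≤ sStar (β * u) u,
      ∫⁻ y, ENNReal.ofReal (Real.exp (s * y)) ∂(ν u)
        = (∫⁻ θ, ENNReal.ofReal (Real.exp (Real.log (Gzero s (β * u) u) * (M θ : ℝ))) ∂Q)
            * ENNReal.ofReal (Real.exp ((x / (u * ε u)) * Lam s (β * u) u)))
    (hg : 0 < g) (hgβ : g < Real.sqrt β) :
    HasExpAsymp (fun u => (ν u).map (fun y => u * ε u * y)) ε (tilt β g) (x * tiltCgf β g) := by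
  have hfin := (hsM _ (Real.log_lt_log hg hgβ)).ne
  have hpos : ∫⁻ θ, ENNReal.ofReal (Real.exp (Real.log g * (M θ : ℝ))) ∂Q ≠ 0 := by
    have hm : Measurable fun θ => ENNReal.ofReal (Real.exp (Real.log g * (M θ : ℝ))) := by
      fun_prop
    rw [← pos_iff_ne_zero, lintegral_pos_iff_support hm]
    have : Function.support (fun θ => ENNReal.ofReal (Real.exp (Real.log g * (M θ : ℝ))))
        = Set.univ := by
      ext θ; simp [Real.exp_pos]
    simp [this]
  refine ⟨_, ENNReal.toReal_pos hpos hfin, ?_⟩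
  filter_upwards [eventually_gt_atTop 0] with u hu
  have hεu := hε u hu
  rw [lintegral_map (by fun_prop) (by fun_prop), ENNReal.ofReal_mul ENNReal.toReal_nonneg,
    ENNReal.ofReal_toReal hfin]
  have h := hmgf u hu _ (mul_tilt_le_sStar hu hβ hg)
  rw [Gzero_tilt hu hg hgβ, Lam_tilt hu hg hgβ] at h
  have h1 : ∀ y, tilt β g * (u * ε u * y) / ε u = u * tilt β g * y := fun y => by field_simp
  have h2 : x / (u * ε u) * (u * tiltCgf β g) = x * tiltCgf β g / ε u := by field_simp
  simpa only [h1, h2] using h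

section
variable {ρ : ℝ → Measure ℝ} {ε : ℝ → ℝ} {β x : ℝ} {I : ℝ → ℝ≥0∞}

lemma limsup_le_neg_iInf_of_hasExpAsymp (hβ : 1 < β) (hx : 0 < x)
    (hρ : ∀ᶠ u in atTop, IsProbabilityMeasure (ρ u))
    (hε : Tendsto ε atTop (nhdsWithin 0 (Set.Ioi 0)))
    (h : ∀ g, 0 < g → g < Real.sqrt β → HasExpAsymp ρ ε (tilt β g) (x * tiltCgf β g))
    (hI : ∀ z : ℝ, I z = if x ≤ z then
      ENNReal.ofReal (x / 2 * (Real.sqrt ((z / x - 1) * β) - Real.sqrt (z / x + 1)) ^ 2)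
      else ⊤) {F : Set ℝ} (hF : IsClosed F) :
    limsup (fun u : ℝ => ((ε u : ℝ) : EReal) * ENNReal.log (ρ u F)) atTop
      ≤ -((⨅ z ∈ F, I z : ℝ≥0∞) : EReal) := by
  rw [← EReal.le_of_forall_lt_iff_le]
  intro B hB
  refine limsup_eps_mul_log_le hε ?_
  rcases le_total 0 B with hB0 | hB0
  · filter_upwards [hρ, hε.eventually self_mem_nhdsWithin] with u hu hpos
    refine prob_le_one.trans ?_
    rw [← ENNReal.ofReal_one]
    exact ENNReal.ofReal_le_ofReal (Real.one_le_exp (div_nonneg hB0 (le_of_lt hpos)))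
  have hB' : ((-B : ℝ) : EReal) < ((⨅ z ∈ F, I z : ℝ≥0∞) : EReal) := by
    rw [EReal.coe_neg]; exact EReal.neg_lt_comm.1 hB
  obtain ⟨A, hBA, hA⟩ := EReal.lt_iff_exists_real_btwn.1 hB'
  have hBA : -B < A := by exact_mod_cast hBA
  have hrate : ∀ z ∈ F, x ≤ z →
      A < x / 2 * (Real.sqrt ((z / x - 1) * β) - Real.sqrt (z / x + 1)) ^ 2 := by
    intro z hz hxz
    have h1 : (A : EReal) < I z :=
      hA.trans_le (EReal.coe_ennreal_le_coe_ennreal_iff.2 (iInf₂_le z hz))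
    rw [hI, if_pos hxz, EReal.coe_ennreal_ofReal, max_eq_left (by positivity)] at h1
    exact_mod_cast h1
  set z₀ := x * (β + 1) / (β - 1)
  have hlow : ∀ᶠ u in atTop, ρ u (F ∩ Set.Iic z₀) ≤ ENNReal.ofReal (Real.exp (-A / ε u)) := by
    rcases (F ∩ Set.Iic z₀).eq_empty_or_nonempty with he | hne
    · simp [he]
    have hbdd : BddAbove (F ∩ Set.Iic z₀) := ⟨z₀, fun y hy => hy.2⟩
    have hmem := (hF.inter isClosed_Iic).csSup_mem hne hbdd
    obtain ⟨g, hg, hgβ, ht, hAg⟩ := exists_tilt_nonpos hβ hx hmem.2 (hrate _ hmem.1)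
    exact (h g hg hgβ).measure_le hε (hF.inter isClosed_Iic).measurableSet
      (fun y hy => mul_le_mul_of_nonpos_left (le_csSup hbdd hy) ht) hAg
  have hup : ∀ᶠ u in atTop, ρ u (F ∩ Set.Ici z₀) ≤ ENNReal.ofReal (Real.exp (-A / ε u)) := by
    rcases (F ∩ Set.Ici z₀).eq_empty_or_nonempty with he | hne
    · simp [he]
    have hbdd : BddBelow (F ∩ Set.Ici z₀) := ⟨z₀, fun y hy => hy.2⟩
    have hmem := (hF.inter isClosed_Ici).csInf_mem hne hbdd
    have hxz : x ≤ sInf (F ∩ Set.Ici z₀) := by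
      refine le_trans ?_ hmem.2
      rw [le_div_iff₀ (by linarith)]
      nlinarith
    obtain ⟨g, hg, hgβ, ht, hAg⟩ := exists_tilt_nonneg hβ hx hmem.2 (hrate _ hmem.1 hxz)
    exact (h g hg hgβ).measure_le hε (hF.inter isClosed_Ici).measurableSet
      (fun y hy => mul_le_mul_of_nonneg_left (csInf_le hbdd hy) ht) hAg
  filter_upwards [hlow, hup, eventually_mul_exp_le hε 2 (by linarith : -A < B)] with u h1 h2 h3
  calc ρ u F ≤ ρ u (F ∩ Set.Iic z₀ ∪ F ∩ Set.Ici z₀) := by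
        rw [← Set.inter_union_distrib_left, Set.Iic_union_Ici, Set.inter_univ]
    _ ≤ _ := (measure_union_le _ _).trans (add_le_add h1 h2)
    _ = ENNReal.ofReal (2 * Real.exp (-A / ε u)) := by
        rw [← ENNReal.ofReal_add (by positivity) (by positivity), two_mul]
    _ ≤ _ := ENNReal.ofReal_le_ofReal h3

lemma neg_iInf_le_liminf_of_hasExpAsymp (hβ : 1 < β) (hx : 0 < x)
    (hρ : ∀ᶠ u in atTop, IsProbabilityMeasure (ρ u))
    (hε : Tendsto ε atTop (nhdsWithin 0 (Set.Ioi 0)))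
    (h : ∀ g, 0 < g → g < Real.sqrt β → HasExpAsymp ρ ε (tilt β g) (x * tiltCgf β g))
    (hI : ∀ z : ℝ, I z = if x ≤ z then
      ENNReal.ofReal (x / 2 * (Real.sqrt ((z / x - 1) * β) - Real.sqrt (z / x + 1)) ^ 2)
      else ⊤) {G : Set ℝ} (hG : IsOpen G) :
    -((⨅ z ∈ G, I z : ℝ≥0∞) : EReal)
      ≤ liminf (fun u : ℝ => ((ε u : ℝ) : EReal) * ENNReal.log (ρ u G)) atTop := by
  rw [← EReal.ge_of_forall_gt_iff_ge]
  intro B hB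
  refine le_liminf_eps_mul_log hε ?_
  have hB' : ((⨅ z ∈ G, I z : ℝ≥0∞) : EReal) < ((-B : ℝ) : EReal) := by
    rw [EReal.coe_neg]; exact EReal.lt_neg_comm.1 hB
  rw [← EReal.coe_toENNReal ((EReal.coe_ennreal_nonneg _).trans hB'.le),
    EReal.coe_ennreal_lt_coe_ennreal_iff] at hB'
  simp only [iInf_lt_iff] at hB'
  obtain ⟨z, hzG, hz⟩ := hB'
  rw [hI] at hz
  have hxz : x ≤ z := by
    by_contra hc
    simp [hc] at hz
  rw [if_pos hxz, EReal.real_coe_toENNReal, ENNReal.ofReal_lt_ofReal_iff'] at hz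
  have hcont : Continuous fun z =>
      x / 2 * (Real.sqrt ((z / x - 1) * β) - Real.sqrt (z / x + 1)) ^ 2 := by fun_prop
  obtain ⟨z', ⟨hz'G, hz'⟩, hzz'⟩ := (((hG.eventually_mem hzG).and
    (hcont.tendsto z |>.eventually_lt_const hz.1)).filter_mono nhdsWithin_le_nhds |>.and
      (self_mem_nhdsWithin (s := Set.Ioi z))).exists
  obtain ⟨g, hg, hgβ, hzg, hr⟩ := exists_tilt_eq_rate hβ hx (hxz.trans_lt hzz')
  rw [← hr] at hz'
  obtain ⟨r, hr0, hrG⟩ := Metric.isOpen_iff.1 hG z' hz'G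
  obtain ⟨δ, hδ, hδr, hδB⟩ : ∃ δ, 0 < δ ∧ δ ≤ r ∧
      B < x * tiltCgf β g - (tilt β g * z' + |tilt β g| * δ) := by
    have hgap : 0 < -B - (tilt β g * z' - x * tiltCgf β g) := by linarith
    have ht : Tendsto (fun δ : ℝ => x * tiltCgf β g - (tilt β g * z' + |tilt β g| * δ))
        (nhdsWithin 0 (Set.Ioi 0)) (nhds (x * tiltCgf β g - (tilt β g * z' + |tilt β g| * 0))) :=
      ((by fun_prop : Continuous fun δ : ℝ =>
        x * tiltCgf β g - (tilt β g * z' + |tilt β g| * δ)).tendsto 0).mono_left nhdsWithin_le_nhds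
    obtain ⟨δ, h1, h2, h3⟩ := ((ht.eventually_const_lt
      (show B < _ by rw [mul_zero]; linarith)).and (Ioo_mem_nhdsGT hr0)).exists
    exact ⟨δ, h2, h3.le, h1⟩
  obtain ⟨g₁, hg₁, hgβ₁, ht₁, hl₁⟩ := exists_tilt_lt hg hgβ hzg hδ
  obtain ⟨g₂, hg₂, hgβ₂, ht₂, hl₂⟩ := exists_tilt_gt hg hgβ hzg hδ
  filter_upwards [(h g hg hgβ).le_measure_Ioo (hρ.mono fun u hu => inferInstance) hε
    (h g₁ hg₁ hgβ₁) (h g₂ hg₂ hgβ₂) ht₁ ht₂ hl₁ hl₂ hδB] with u hu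
  refine hu.trans (measure_mono ?_)
  rw [← Real.ball_eq_Ioo]
  exact (Metric.ball_subset_ball hδr).trans hrG
end

/-- STATEMENT 19 (non-central moderate deviations: LDP for `με_μ·A_{x/(με_μ)}(βμ,μ)` as
`μ → ∞`, with speed `1/ε_μ` and good rate function `I₂(z) = x·H_A(z/x;β,1)`, Case A:
`s_M ≥ log√β`, encoded as `G_M(r) < ∞` for every `r < log√β`). -/
theorem ncmd_scaling2
    {Θ : Type*} [MeasurableSpace Θ] (Q : Measure Θ) [IsProbabilityMeasure Q]
    (M : Θ → ℕ) (hMmeas : Measurable M) (hM1 : ∀ θ, 1 ≤ M θ)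
    (β x : ℝ) (hβ : 1 < β) (hx : 0 < x)
    -- Condition (*) with s_M ≥ log√β
    (hsM : ∀ r : ℝ, r < Real.log (Real.sqrt β) →
      ∫⁻ θ, ENNReal.ofReal (Real.exp (r * (M θ : ℝ))) ∂Q < ⊤)
    -- the scaling ε_μ
    (ε : ℝ → ℝ) (hε : ∀ u > 0, 0 < ε u)
    (hε0 : Tendsto ε atTop (nhds 0)) (huε : Tendsto (fun u => u * ε u) atTop atTop)
    -- the laws ν_μ of the absorption times A_{x/(με_μ)}(βμ,μ)
    (ν : ℝ → Measure ℝ) (hprob : ∀ u > 0, IsProbabilityMeasure (ν u))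
    (hsupp : ∀ u > 0, ν u (Set.Iio 0) = 0)
    (hmgf_le : ∀ u > 0, ∀ s ≤ sStar (β * u) u,
      ∫⁻ y, ENNReal.ofReal (Real.exp (s * y)) ∂(ν u)
        = (∫⁻ θ, ENNReal.ofReal (Real.exp (Real.log (Gzero s (β * u) u) * (M θ : ℝ))) ∂Q)
            * ENNReal.ofReal (Real.exp ((x / (u * ε u)) * Lam s (β * u) u)))
    (hmgf_gt : ∀ u > 0, ∀ s > sStar (β * u) u,
      ∫⁻ y, ENNReal.ofReal (Real.exp (s * y)) ∂(ν u) = ⊤)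
    -- the rate function I₂
    (I : ℝ → ℝ≥0∞)
    (hI : ∀ z : ℝ, I z = if x ≤ z then
      ENNReal.ofReal (x / 2 * (Real.sqrt ((z / x - 1) * β) - Real.sqrt (z / x + 1)) ^ 2)
      else ⊤) :
    -- (a) upper bound for closed sets
    (∀ F : Set ℝ, IsClosed F →
      limsup (fun u : ℝ => ((ε u : ℝ) : EReal) *
          ENNReal.log (ν u {y | u * ε u * y ∈ F})) atTop
        ≤ -((⨅ z ∈ F, I z : ℝ≥0∞) : EReal))
    -- (b) lower bound for open sets
    ∧ (∀ G : Set ℝ, IsOpen G →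
      -((⨅ z ∈ G, I z : ℝ≥0∞) : EReal)
        ≤ liminf (fun u : ℝ => ((ε u : ℝ) : EReal) *
            ENNReal.log (ν u {y | u * ε u * y ∈ G})) atTop) := by
  have hε' : Tendsto ε atTop (nhdsWithin 0 (Set.Ioi 0)) :=
    tendsto_nhdsWithin_iff.2 ⟨hε0, (eventually_gt_atTop 0).mono fun u hu => hε u hu⟩
  have hρ : ∀ᶠ u in atTop, IsProbabilityMeasure ((ν u).map (fun y => u * ε u * y)) := by
    filter_upwards [eventually_gt_atTop 0] with u hu
    have := hprob u hu
    exact Measure.isProbabilityMeasure_map (by fun_prop)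
  have h := fun g (hg : 0 < g) (hgβ : g < Real.sqrt β) =>
    hasExpAsymp_map_of_mgf hMmeas (zero_lt_one.trans hβ) hsM hε hmgf_le hg hgβ
  have hmap : ∀ S : Set ℝ, MeasurableSet S → ∀ u,
      ν u {y | u * ε u * y ∈ S} = (ν u).map (fun y => u * ε u * y) S := fun S hS u =>
    (Measure.map_apply (by fun_prop) hS).symm
  refine ⟨fun F hF => ?_, fun G hG => ?_⟩
  · simp only [hmap F hF.measurableSet]
    exact limsup_le_neg_iInf_of_hasExpAsymp hβ hx hρ hε' h hI hF
  · simp only [hmap G hG.measurableSet]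
    exact neg_iInf_le_liminf_of_hasExpAsymp hβ hx hρ hε' h hI hG
end
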